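/- Let N ≥ 3, m > 1, T > 0, R > 0, and let ρ satisfy the weight condition. Let u ≥ 0 be such that u ∈ L¹_ρ(B_R×(0,S)) and u^m ∈ L¹(B_R×(0,S)) for every S ∈ (0,T), and suppose there exists g ∈ L¹(∂B_R×(0,T), dσ⊗dt) such that ∫_0^T ∫_{B_R} ( u ψ_t ρ + u^m Δψ ) dx dt = ∫_0^T ∫_{∂B_R} g ∂_ν ψ dσ dt for every ψ ∈ C^∞(B̄_R×(0,T)) with compact support in time which vanishes on ∂B_R×(0,T) (here ∂_ν is the outer normal derivative and σ the surface measure on ∂B_R). Then u ∈ L^{m+1}_{ρ,loc}(B_R×(0,T)); that is, ∫∫_K u^{m+1} ρ dx dt < ∞ for every compact K ⊂ B_R×(0,T). -/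

import Mathlib

open MeasureTheory Set Metric Filter
open scoped ENNReal Topology

noncomputable section

abbrev Eu (N : ℕ) := EuclideanSpace ℝ (Fin N)

/-- Signed power `a^q = |a|^{q-1} a`. -/
def spow (a q : ℝ) : ℝ := |a| ^ (q - 1) * a

/-- The weight condition \eqref{weight-cond}: `ρ` is measurable and
`C̲ (1+|x|)^{-γ} ≤ ρ(x) ≤ C̄ |x|^{-γ}` for a.e. `x`, with `γ ∈ [0,2)` and `0 < C̲ < C̄`. -/
def WeightCond (N : ℕ) (γ Cl Cu : ℝ) (ρ : Eu N → ℝ) : Prop :=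
  Measurable ρ ∧ 0 ≤ γ ∧ γ < 2 ∧ 0 < Cl ∧ Cl < Cu ∧
    ∀ᵐ x ∂(volume : Measure (Eu N)), Cl * (1 + ‖x‖) ^ (-γ) ≤ ρ x ∧ ρ x ≤ Cu * ‖x‖ ^ (-γ)

/-- Time derivative `ψ_t` of a space-time test function. -/
def ptder {N : ℕ} (ψ : Eu N × ℝ → ℝ) (p : Eu N × ℝ) : ℝ := fderiv ℝ ψ p (0, 1)

/-- Spatial Laplacian `Δψ` of a space-time test function. -/
def lapX {N : ℕ} (ψ : Eu N × ℝ → ℝ) (p : Eu N × ℝ) : ℝ :=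
  ∑ i : Fin N, fderiv ℝ (fun q => fderiv ℝ ψ q (EuclideanSpace.single i 1, 0)) p
    (EuclideanSpace.single i 1, 0)

/-- Very weak solution of `ρ u_t = Δ(u^m)` in `Ω × (τ₁, τ₂)` (Definitions 2.6 / 2.8). -/
structure VWS {N : ℕ} (ρ : Eu N → ℝ) (m : ℝ) (Ω : Set (Eu N)) (τ₁ τ₂ : ℝ)
    (u : Eu N → ℝ → ℝ) : Prop where
  aemeas : AEMeasurable (fun p : Eu N × ℝ => u p.1 p.2)
    (volume.restrict (Ω ×ˢ Ioo τ₁ τ₂))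
  locint : ∀ K : Set (Eu N × ℝ), IsCompact K → K ⊆ Ω ×ˢ Ioo τ₁ τ₂ →
    IntegrableOn (fun p : Eu N × ℝ => |u p.1 p.2| * ρ p.1) K ∧
      IntegrableOn (fun p : Eu N × ℝ => |u p.1 p.2| ^ m) K
  weak : ∀ ψ : Eu N × ℝ → ℝ, ContDiff ℝ (⊤ : ℕ∞) ψ → HasCompactSupport ψ →
    tsupport ψ ⊆ Ω ×ˢ Ioo τ₁ τ₂ →
    ∫ p in Ω ×ˢ Ioo τ₁ τ₂,
      (u p.1 p.2 * ptder ψ p * ρ p.1 + spow (u p.1 p.2) m * lapX ψ p) = 0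

/-- `u ∈ L^∞_loc(Ω × (τ₁,τ₂))`. -/
def LinftyLoc {N : ℕ} (Ω : Set (Eu N)) (τ₁ τ₂ : ℝ) (u : Eu N → ℝ → ℝ) : Prop :=
  ∀ K : Set (Eu N × ℝ), IsCompact K → K ⊆ Ω ×ˢ Ioo τ₁ τ₂ →
    ∃ M : ℝ, ∀ᵐ p ∂(volume.restrict K : Measure (Eu N × ℝ)), |u p.1 p.2| ≤ M

/-- The `i`-th standard basis vector. -/
abbrev ee {N : ℕ} (i : Fin N) : Eu N := EuclideanSpace.single i 1

/-- The Laplacian, written with the same iterated derivatives as `lapX`. -/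
def lap {N : ℕ} (G : Eu N → ℝ) (y : Eu N) : ℝ :=
  ∑ i : Fin N, fderiv ℝ (fun q => fderiv ℝ G q (ee i)) y (ee i)

lemma contDiff_fderiv_apply_const {N : ℕ} {G : Eu N → ℝ} (hG : ContDiff ℝ (⊤ : ℕ∞) G) (v : Eu N) :
    ContDiff ℝ (⊤ : ℕ∞) (fun q => fderiv ℝ G q v) :=
  (hG.fderiv_right (by simp)).clm_apply contDiff_const

lemma continuous_lap {N : ℕ} {G : Eu N → ℝ} (hG : ContDiff ℝ (⊤ : ℕ∞) G) : Continuous (lap G) := by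
  refine continuous_finsetSum _ fun i _ => ?_
  exact (contDiff_fderiv_apply_const (contDiff_fderiv_apply_const hG _) _).continuous

lemma fderiv_tensor {N : ℕ} {G : Eu N → ℝ} {a : ℝ → ℝ} (hG : ContDiff ℝ (⊤ : ℕ∞) G)
    (ha : ContDiff ℝ (⊤ : ℕ∞) a) (p : Eu N × ℝ) (v : Eu N) (s : ℝ) :
    fderiv ℝ (fun p : Eu N × ℝ => G p.1 * a p.2) p (v, s) =
      fderiv ℝ G p.1 v * a p.2 + G p.1 * (s * deriv a p.2) := by
  have h1 : HasFDerivAt (fun p : Eu N × ℝ => G p.1)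
      ((fderiv ℝ G p.1).comp (ContinuousLinearMap.fst ℝ (Eu N) ℝ)) p :=
    ((hG.differentiable (by simp)) p.1).hasFDerivAt.comp p hasFDerivAt_fst
  have h2 : HasFDerivAt (fun p : Eu N × ℝ => a p.2)
      ((fderiv ℝ a p.2).comp (ContinuousLinearMap.snd ℝ (Eu N) ℝ)) p :=
    ((ha.differentiable (by simp)) p.2).hasFDerivAt.comp p hasFDerivAt_snd
  rw [(h1.fun_mul h2).fderiv]
  have : fderiv ℝ a p.2 s = s * deriv a p.2 := by
    rw [fderiv_eq_smul_deriv]; simp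
  simp [this]
  ring

lemma ptder_tensor {N : ℕ} {G : Eu N → ℝ} {a : ℝ → ℝ} (hG : ContDiff ℝ (⊤ : ℕ∞) G)
    (ha : ContDiff ℝ (⊤ : ℕ∞) a) (p : Eu N × ℝ) :
    ptder (fun p : Eu N × ℝ => G p.1 * a p.2) p = G p.1 * deriv a p.2 := by
  rw [ptder, fderiv_tensor hG ha]; simp

lemma lapX_tensor {N : ℕ} {G : Eu N → ℝ} {a : ℝ → ℝ} (hG : ContDiff ℝ (⊤ : ℕ∞) G)
    (ha : ContDiff ℝ (⊤ : ℕ∞) a) (p : Eu N × ℝ) :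
    lapX (fun p : Eu N × ℝ => G p.1 * a p.2) p = a p.2 * lap G p.1 := by
  rw [lapX, lap, Finset.mul_sum]
  refine Finset.sum_congr rfl fun i _ => ?_
  have h : (fun q => fderiv ℝ (fun p : Eu N × ℝ => G p.1 * a p.2) q (EuclideanSpace.single i 1, 0))
      = fun q : Eu N × ℝ => (fderiv ℝ G q.1 (ee i)) * a q.2 := by
    ext q; rw [fderiv_tensor hG ha]; simp
  rw [h, fderiv_tensor (contDiff_fderiv_apply_const hG _) ha]
  simp [mul_comm]

lemma fderiv_mul_apply {N : ℕ} {G H : Eu N → ℝ} (hG : ContDiff ℝ (⊤ : ℕ∞) G)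
    (hH : ContDiff ℝ (⊤ : ℕ∞) H) (y v : Eu N) :
    fderiv ℝ (fun y => G y * H y) y v = G y * fderiv ℝ H y v + H y * fderiv ℝ G y v := by
  rw [fderiv_fun_mul (hG.differentiable (by simp) y) (hH.differentiable (by simp) y)]
  simp

lemma lap_mul {N : ℕ} {G H : Eu N → ℝ} (hG : ContDiff ℝ (⊤ : ℕ∞) G)
    (hH : ContDiff ℝ (⊤ : ℕ∞) H) (y : Eu N) :
    lap (fun y => G y * H y) y = G y * lap H y +
      (2 * ∑ i, fderiv ℝ G y (ee i) * fderiv ℝ H y (ee i) + H y * lap G y) := by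
  simp only [lap, Finset.mul_sum, ← Finset.sum_add_distrib]
  refine Finset.sum_congr rfl fun i _ => ?_
  have hG' := contDiff_fderiv_apply_const hG (ee i)
  have hH' := contDiff_fderiv_apply_const hH (ee i)
  have h : (fun q => fderiv ℝ (fun y => G y * H y) q (ee i)) =
      fun q => G q * fderiv ℝ H q (ee i) + H q * fderiv ℝ G q (ee i) := by
    ext q; exact fderiv_mul_apply hG hH q _
  rw [h, fderiv_fun_add ((hG.mul hH').differentiable (by simp) y)
    ((hH.mul hG').differentiable (by simp) y), _root_.add_apply,
    fderiv_mul_apply hG hH', fderiv_mul_apply hH hG']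
  ring

lemma lap_add {N : ℕ} {G H : Eu N → ℝ} (hG : ContDiff ℝ (⊤ : ℕ∞) G)
    (hH : ContDiff ℝ (⊤ : ℕ∞) H) (y : Eu N) :
    lap (fun y => G y + H y) y = lap G y + lap H y := by
  simp only [lap, ← Finset.sum_add_distrib]
  refine Finset.sum_congr rfl fun i _ => ?_
  have hG' := contDiff_fderiv_apply_const hG (ee i)
  have hH' := contDiff_fderiv_apply_const hH (ee i)
  have h : (fun q => fderiv ℝ (fun y => G y + H y) q (ee i)) =
      fun q => fderiv ℝ G q (ee i) + fderiv ℝ H q (ee i) := by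
    ext q
    rw [fderiv_fun_add (hG.differentiable (by simp) q) (hH.differentiable (by simp) q)]; rfl
  rw [h, fderiv_fun_add (hG'.differentiable (by simp) y) (hH'.differentiable (by simp) y)]
  rfl

/-- The regularised squared distance. -/
def qq {N : ℕ} (ε : ℝ) (x y : Eu N) : ℝ := ‖y - x‖ ^ 2 + ε ^ 2

/-- The regularised Riesz kernel `|x - y|^{-b} / b`. -/
def kern {N : ℕ} (b ε : ℝ) (x y : Eu N) : ℝ := qq ε x y ^ (-b / 2) / b

lemma qq_pos {N : ℕ} {ε : ℝ} (hε : 0 < ε) (x y : Eu N) : 0 < qq ε x y := by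
  unfold qq; positivity

lemma qq_comm {N : ℕ} (ε : ℝ) (x y : Eu N) : qq ε x y = qq ε y x := by
  unfold qq; rw [norm_sub_rev]

lemma kern_comm {N : ℕ} (b ε : ℝ) (x y : Eu N) : kern b ε x y = kern b ε y x := by
  unfold kern; rw [qq_comm]

lemma contDiff_qq_rpow {N : ℕ} {ε : ℝ} (hε : 0 < ε) (r : ℝ) (x : Eu N) :
    ContDiff ℝ (⊤ : ℕ∞) (fun y => qq ε x y ^ r) := by
  refine ContDiff.rpow_const_of_ne ?_ fun y => (qq_pos hε x y).ne'
  exact ((contDiff_id.sub contDiff_const).norm_sq ℝ).add contDiff_const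

lemma contDiff_kern {N : ℕ} {ε : ℝ} (hε : 0 < ε) (b : ℝ) (x : Eu N) :
    ContDiff ℝ (⊤ : ℕ∞) (fun y => kern b ε x y) :=
  (contDiff_qq_rpow hε _ x).div_const _

lemma fderiv_qq_rpow {N : ℕ} {ε : ℝ} (hε : 0 < ε) (r : ℝ) (x y v : Eu N) :
    fderiv ℝ (fun y => qq ε x y ^ r) y v = 2 * r * qq ε x y ^ (r - 1) * inner ℝ (y - x) v := by
  have h1 : HasFDerivAt (fun y : Eu N => qq ε x y) _ y :=
    (((hasFDerivAt_id y).sub_const x).norm_sq).add_const (ε ^ 2)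
  rw [(h1.rpow_const (p := r) (Or.inl (qq_pos hε x y).ne')).fderiv]
  simp [inner_sub_left]
  ring

lemma fderiv_kern {N : ℕ} {ε : ℝ} (hε : 0 < ε) {b : ℝ} (hb : b ≠ 0) (x y v : Eu N) :
    fderiv ℝ (fun y => kern b ε x y) y v = -(qq ε x y ^ (-b / 2 - 1) * inner ℝ (y - x) v) := by
  unfold kern
  have h := (contDiff_qq_rpow hε (-b / 2) x).differentiable (by simp) y
  have h2 : (fun y => qq ε x y ^ (-b / 2) / b) = fun y => b⁻¹ * qq ε x y ^ (-b / 2) := by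
    ext; rw [div_eq_inv_mul]
  rw [h2, fderiv_const_mul h, _root_.smul_apply, fderiv_qq_rpow hε]
  simp only [smul_eq_mul]
  field_simp

lemma lap_kern {N : ℕ} {ε : ℝ} (hε : 0 < ε) {b : ℝ} (hb : b ≠ 0) (x y : Eu N) :
    lap (fun y => kern b ε x y) y =
      -(qq ε x y ^ (-b / 2 - 2) * ((N - b - 2) * ‖y - x‖ ^ 2 + N * ε ^ 2)) := by
  have key : ∀ i : Fin N, fderiv ℝ (fun q => fderiv ℝ (fun y => kern b ε x y) q (ee i)) y (ee i) =
      (b + 2) * qq ε x y ^ (-b / 2 - 2) * (y - x) i ^ 2 - qq ε x y ^ (-b / 2 - 1) := by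
    intro i
    have h : (fun q => fderiv ℝ (fun y => kern b ε x y) q (ee i)) =
        fun q => (qq ε x q ^ (-b / 2 - 1)) * (-inner ℝ (q - x) (ee i)) := by
      ext q; rw [fderiv_kern hε hb]; ring
    have hc : ContDiff ℝ (⊤ : ℕ∞) (fun q : Eu N => -inner ℝ (q - x) (ee i)) :=
      ((contDiff_id.sub contDiff_const).inner ℝ contDiff_const).neg
    have hd : fderiv ℝ (fun q : Eu N => -inner ℝ (q - x) (ee i)) y (ee i) = -1 := by
      have h1 : HasFDerivAt (fun q : Eu N => -inner ℝ (q - x) (ee i)) _ y :=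
        (((hasFDerivAt_id y).sub_const x).inner ℝ (hasFDerivAt_const (ee i) y)).neg
      rw [h1.fderiv]
      simp
    rw [h, fderiv_mul_apply (contDiff_qq_rpow hε _ x) hc, fderiv_qq_rpow hε, hd]
    have hin : inner ℝ (y - x) (ee i) = (y - x) i := by
      simp [EuclideanSpace.inner_single_right]
    rw [show -b / 2 - 1 - 1 = -b / 2 - 2 by ring, hin]
    ring
  have hq : qq ε x y ^ (-b / 2 - 1) = qq ε x y ^ (-b / 2 - 2) * qq ε x y := by
    rw [← Real.rpow_add_one (qq_pos hε x y).ne']; congr 1; ring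
  have hn : ∑ i, (y - x) i ^ 2 = ‖y - x‖ ^ 2 := (EuclideanSpace.real_norm_sq_eq (y - x)).symm
  rw [lap, Finset.sum_congr rfl fun i _ => key i, Finset.sum_sub_distrib, ← Finset.mul_sum, hn, hq]
  simp only [Finset.sum_const, Finset.card_univ, Fintype.card_fin, nsmul_eq_mul]
  unfold qq
  ring

lemma absorb_power {n j : ℕ} (hj : 0 < j) {C c H e d : ℝ} (hC : 0 ≤ C) (hc : 0 < c)
    (hed : e ≤ (d - e) * (n / j)) :
    ∃ C' : ℝ, 0 ≤ C' ∧ ∀ s h : ℝ, 0 ≤ s → 0 < h → h ≤ H →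
      C * (s ^ n * h ^ (-e)) ≤ c * (s ^ (n + j) * h ^ (-d)) + C' := by
  rcases le_or_gt H 0 with hH | hH
  · exact ⟨0, le_rfl, fun s h _ h1 h2 => absurd (h1.trans_le h2) (not_lt.2 hH)⟩
  refine ⟨C * ((C / c) ^ ((n : ℝ) / j) * H ^ ((d - e) * (n / j) - e)), by positivity, ?_⟩
  intro s h hs hh hhH
  rcases le_or_gt C (c * (s ^ j * h ^ (e - d))) with h1 | h1
  · have h2 : C * (s ^ n * h ^ (-e)) ≤ c * (s ^ j * h ^ (e - d)) * (s ^ n * h ^ (-e)) := by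
      gcongr
    have h3 : c * (s ^ j * h ^ (e - d)) * (s ^ n * h ^ (-e)) = c * (s ^ (n + j) * h ^ (-d)) := by
      rw [show -d = (e - d) + (-e) by ring, Real.rpow_add hh]; ring
    have h4 : 0 ≤ C * ((C / c) ^ ((n : ℝ) / j) * H ^ ((d - e) * (n / j) - e)) := by positivity
    linarith
  · have hj' : (j : ℝ) ≠ 0 := by positivity
    have h2 : s ^ j ≤ C / c * h ^ (d - e) := by
      rw [show e - d = -(d - e) by ring, Real.rpow_neg hh.le] at h1
      have hp : 0 < h ^ (d - e) := by positivity
      rw [div_mul_eq_mul_div, le_div_iff₀ hc]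
      have h3 : c * (s ^ j * (h ^ (d - e))⁻¹) * h ^ (d - e) ≤ C * h ^ (d - e) := by gcongr
      rw [mul_assoc, mul_assoc, inv_mul_cancel₀ hp.ne'] at h3
      linarith
    have h3 : s ^ n = (s ^ j) ^ ((n : ℝ) / j) := by
      rw [← Real.rpow_natCast s j, ← Real.rpow_mul hs, mul_div_cancel₀ _ hj', Real.rpow_natCast]
    have h4 : s ^ n * h ^ (-e) ≤ (C / c) ^ ((n : ℝ) / j) * H ^ ((d - e) * (n / j) - e) := by
      calc s ^ n * h ^ (-e) ≤ (C / c * h ^ (d - e)) ^ ((n : ℝ) / j) * h ^ (-e) := by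
            rw [h3]; gcongr
        _ = (C / c) ^ ((n : ℝ) / j) * h ^ ((d - e) * (n / j) - e) := by
            rw [Real.mul_rpow (by positivity) (by positivity), ← Real.rpow_mul hh.le, mul_assoc,
              ← Real.rpow_add hh]; rfl
        _ ≤ _ := by
            gcongr
    have h5 : 0 ≤ c * (s ^ (n + j) * h ^ (-d)) := by positivity
    nlinarith [mul_le_mul_of_nonneg_left h4 hC]

/-- A spatial cutoff supported in the closed ball of radius `r`, together with bounds on the
derivatives of its power of order `n + 2`. -/
structure IsCutoff {N : ℕ} (r : ℝ) (n : ℕ) (A : ℝ) (χ : Eu N → ℝ) : Prop where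
  smooth : ContDiff ℝ (⊤ : ℕ∞) χ
  nonneg : ∀ y, 0 ≤ χ y
  le_one : ∀ y, χ y ≤ 1
  zero : ∀ y, r < ‖y‖ → χ y = 0
  bound_nonneg : 0 ≤ A
  fderiv_bound : ∀ y i, |fderiv ℝ (fun y => χ y ^ (n + 2)) y (ee i)| ≤ A * χ y ^ (n + 1)
  lap_bound : ∀ y, |lap (fun y => χ y ^ (n + 2)) y| ≤ A * χ y ^ n

lemma fderiv_pow_apply {N : ℕ} {χ : Eu N → ℝ} (hχ : ContDiff ℝ (⊤ : ℕ∞) χ) (k : ℕ)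
    (y v : Eu N) :
    fderiv ℝ (fun y => χ y ^ (k + 1)) y v = (k + 1) * χ y ^ k * fderiv ℝ χ y v := by
  rw [(((hχ.differentiable (by simp)) y).hasFDerivAt.pow (k + 1)).fderiv]
  simp

lemma exists_isCutoff (N : ℕ) {r₁ r₂ : ℝ} (h₁ : 0 < r₁) (h₂ : r₁ < r₂) (n : ℕ) :
    ∃ (A : ℝ) (χ : Eu N → ℝ), IsCutoff r₂ n A χ ∧ ∀ y, ‖y‖ ≤ r₁ → χ y = 1 := by
  let f : ContDiffBump (0 : Eu N) := ⟨r₁, r₂, h₁, h₂⟩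
  have hs : ContDiff ℝ (⊤ : ℕ∞) (fun y => f y) := f.contDiff
  have hd : ∀ i, ∃ C, ∀ y, ‖fderiv ℝ (fun y => f y) y (ee i)‖ ≤ C := fun i =>
    (f.hasCompactSupport.fderiv_apply ℝ (ee i)).exists_bound_of_continuous
      (contDiff_fderiv_apply_const hs _).continuous
  have hd2 : ∀ i, ∃ C, ∀ y, ‖fderiv ℝ (fun q => fderiv ℝ (fun y => f y) q (ee i)) y (ee i)‖ ≤ C :=
    fun i => ((f.hasCompactSupport.fderiv_apply ℝ (ee i)).fderiv_apply ℝ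
      (ee i)).exists_bound_of_continuous
      (contDiff_fderiv_apply_const (contDiff_fderiv_apply_const hs _) _).continuous
  choose C hC using hd
  choose D hD using hd2
  have hC0 : ∀ i, 0 ≤ C i := fun i => (norm_nonneg _).trans (hC i 0)
  have hD0 : ∀ i, 0 ≤ D i := fun i => (norm_nonneg _).trans (hD i 0)
  have f0 : ∀ y, 0 ≤ f y := fun y => f.nonneg
  set B : ℝ := ∑ i, ((n + 2) * C i + ((n + 2) * ((n + 1) * (C i * C i)) + (n + 2) * D i)) with hB
  have hBi : ∀ i, 0 ≤ (n + 2) * C i + ((n + 2) * ((n + 1) * (C i * C i)) + (n + 2) * D i) := by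
    intro i
    have := hC0 i
    have := hD0 i
    positivity
  refine ⟨B, fun y => f y, ⟨hs, f0, fun y => f.le_one, ?_, Finset.sum_nonneg fun i _ => hBi i,
    ?_, ?_⟩, ?_⟩
  · intro y hy
    exact f.zero_of_le_dist (by simpa using hy.le)
  · intro y i
    have h := fderiv_pow_apply hs (n + 1) y (ee i)
    rw [show n + 2 = n + 1 + 1 from rfl, h, abs_mul, abs_mul, abs_of_nonneg (pow_nonneg (f0 y) _)]
    have h1 : (n + 2) * C i ≤ B := by
      refine le_trans ?_ (Finset.single_le_sum (fun i _ => hBi i) (Finset.mem_univ i))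
      have := hC0 i
      have := hD0 i
      have : 0 ≤ (n + 2) * ((n + 1) * (C i * C i)) + (n + 2) * D i := by positivity
      linarith
    have h2 : |(((n + 1 : ℕ) : ℝ) + 1)| = n + 2 := by
      rw [abs_of_nonneg (by positivity)]; push_cast; ring
    rw [h2]
    calc (n + 2) * f y ^ (n + 1) * |fderiv ℝ (fun y => f y) y (ee i)|
        ≤ (n + 2) * f y ^ (n + 1) * C i := by
          have := f0 y
          gcongr
          exact hC i y
      _ = ((n + 2) * C i) * f y ^ (n + 1) := by ring
      _ ≤ _ := by
          have := f0 y
          gcongr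
  · intro y
    rw [lap]
    refine (Finset.abs_sum_le_sum_abs _ _).trans ?_
    rw [hB, Finset.sum_mul]
    refine Finset.sum_le_sum fun i _ => ?_
    have h : (fun q => fderiv ℝ (fun y => f y ^ (n + 2)) q (ee i)) =
        fun q => ((n + 2) * f q ^ (n + 1)) * fderiv ℝ (fun y => f y) q (ee i) := by
      ext q
      rw [show n + 2 = n + 1 + 1 from rfl, fderiv_pow_apply hs (n + 1)]
      push_cast; ring
    have h' : fderiv ℝ (fun y => ((n : ℝ) + 2) * f y ^ (n + 1)) y (ee i) =
        (n + 2) * ((n + 1) * f y ^ n * fderiv ℝ (fun y => f y) y (ee i)) := by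
      rw [fderiv_const_mul ((hs.pow (n + 1)).differentiable (by simp) y), _root_.smul_apply,
        fderiv_pow_apply hs n]
      rfl
    rw [h, fderiv_mul_apply (contDiff_const.mul (hs.pow _)) (contDiff_fderiv_apply_const hs _), h']
    have hy := f0 y
    have hy1 : f y ≤ 1 := f.le_one
    have a1 := hC i y
    have a2 := hD i y
    rw [Real.norm_eq_abs] at a1 a2
    set P := fderiv ℝ (fun y => f y) y (ee i)
    set Q := fderiv ℝ (fun q => fderiv ℝ (fun y => f y) q (ee i)) y (ee i)
    have hCi := hC0 i
    have hDi := hD0 i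
    calc |(n + 2) * f y ^ (n + 1) * Q + P * ((n + 2) * ((n + 1) * f y ^ n * P))|
        ≤ |(n + 2) * f y ^ (n + 1) * Q| + |P * ((n + 2) * ((n + 1) * f y ^ n * P))| :=
          abs_add_le _ _
      _ = (n + 2) * f y ^ (n + 1) * |Q| + |P| * ((n + 2) * ((n + 1) * f y ^ n * |P|)) := by
          have e1 : |(n : ℝ) + 2| = n + 2 := abs_of_nonneg (by positivity)
          have e2 : |(n : ℝ) + 1| = n + 1 := abs_of_nonneg (by positivity)
          simp only [abs_mul, abs_of_nonneg (pow_nonneg hy _), e1, e2]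
      _ ≤ (n + 2) * f y ^ n * D i + C i * ((n + 2) * ((n + 1) * f y ^ n * C i)) := by
          have : f y ^ (n + 1) ≤ f y ^ n := pow_le_pow_of_le_one hy hy1 (by omega)
          gcongr
      _ ≤ _ := by
          have : 0 ≤ (n + 2) * C i * f y ^ n := by positivity
          linarith
  · intro y hy
    exact f.one_of_mem_closedBall (by simpa using hy)

lemma abs_fderiv_kern_le {N : ℕ} {ε : ℝ} (hε : 0 < ε) {b : ℝ} (hb : b ≠ 0) (x y : Eu N)
    (i : Fin N) :
    |fderiv ℝ (fun y => kern b ε x y) y (ee i)| ≤ qq ε x y ^ (-((b + 1) / 2)) := by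
  have hq := qq_pos hε x y
  have h1 : |inner ℝ (y - x) (ee i)| ≤ qq ε x y ^ (1 / 2 : ℝ) := by
    refine (abs_real_inner_le_norm _ _).trans ?_
    rw [← Real.sqrt_eq_rpow]
    refine Real.le_sqrt_of_sq_le ?_
    simp [qq]
    positivity
  rw [fderiv_kern hε hb, abs_neg, abs_mul, abs_of_pos (Real.rpow_pos_of_pos hq _)]
  calc qq ε x y ^ (-b / 2 - 1) * |inner ℝ (y - x) (ee i)|
      ≤ qq ε x y ^ (-b / 2 - 1) * qq ε x y ^ (1 / 2 : ℝ) := by gcongr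
    _ = _ := by rw [← Real.rpow_add hq]; congr 1; ring

lemma cross_bound {N : ℕ} {r A : ℝ} {n : ℕ} {χ : Eu N → ℝ} (hχ : IsCutoff r n A χ)
    (hn : 2 * N ≤ n) {b c η : ℝ} (hb : b ≠ 0) (hbc : b + 3 / 2 ≤ c) (hbN : b + 1 ≤ N) (hη : 0 < η)
    (Q : ℝ) :
    ∃ C : ℝ, 0 ≤ C ∧ ∀ ε : ℝ, 0 < ε → ∀ x y : Eu N, qq ε x y ≤ Q →
      |lap (fun y => χ y ^ (n + 2) * kern b ε x y) y -
        χ y ^ (n + 2) * lap (fun y => kern b ε x y) y| ≤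
        η * (χ y ^ (n + 2) * qq ε x y ^ (-(c / 2))) + C := by
  have hA := hχ.bound_nonneg
  have hnN : 2 * (N : ℝ) ≤ n := by exact_mod_cast hn
  have hn0 : (0 : ℝ) ≤ n := by positivity
  obtain ⟨C₁, hC₁, h₁⟩ := absorb_power (n := n + 1) (j := 1) one_pos (C := 2 * (N * A))
    (c := η / 2) (H := Q) (e := (b + 1) / 2) (d := c / 2) (by positivity) (by positivity) (by
      push_cast
      rw [div_one]
      have : (1 / 4 : ℝ) * (n + 1) ≤ (c / 2 - (b + 1) / 2) * (n + 1) := by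
        gcongr; linarith
      linarith)
  obtain ⟨C₂, hC₂, h₂⟩ := absorb_power (n := n) (j := 2) two_pos (C := A / |b|)
    (c := η / 2) (H := Q) (e := b / 2) (d := c / 2) (by positivity) (by positivity) (by
      push_cast
      have : (3 / 4 : ℝ) * (n / 2) ≤ (c / 2 - b / 2) * (n / 2) := by
        gcongr; linarith
      linarith)
  refine ⟨C₁ + C₂, by positivity, fun ε hε x y hQ => ?_⟩
  have hq := qq_pos hε x y
  have hy := hχ.nonneg y
  rw [lap_mul (hχ.smooth.pow _) (contDiff_kern hε b x), add_sub_cancel_left]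
  refine (abs_add_le _ _).trans ?_
  have k1 : |2 * ∑ i, fderiv ℝ (fun y => χ y ^ (n + 2)) y (ee i) *
      fderiv ℝ (fun y => kern b ε x y) y (ee i)| ≤
      2 * (N * A) * (χ y ^ (n + 1) * qq ε x y ^ (-((b + 1) / 2))) := by
    rw [abs_mul, abs_two, mul_assoc]
    gcongr
    refine (Finset.abs_sum_le_sum_abs _ _).trans ?_
    calc _ ≤ ∑ i : Fin N, (A * χ y ^ (n + 1)) * qq ε x y ^ (-((b + 1) / 2)) := by
          refine Finset.sum_le_sum fun i _ => ?_
          rw [abs_mul]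
          gcongr
          · exact hχ.fderiv_bound y i
          · exact abs_fderiv_kern_le hε hb x y i
      _ = _ := by simp; ring
  have k2 : |kern b ε x y * lap (fun y => χ y ^ (n + 2)) y| ≤
      A / |b| * (χ y ^ n * qq ε x y ^ (-(b / 2))) := by
    rw [abs_mul, kern, abs_div, abs_of_pos (Real.rpow_pos_of_pos hq _), neg_div]
    calc _ ≤ qq ε x y ^ (-(b / 2)) / |b| * (A * χ y ^ n) := by
          gcongr
          exact hχ.lap_bound y
      _ = _ := by ring
  have k3 := h₁ (χ y) _ hy hq hQ
  have k4 := h₂ (χ y) _ hy hq hQ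
  simp only [show n + 1 + 1 = n + 2 from rfl] at k3
  linarith

lemma lap_kern_le {N : ℕ} {ε : ℝ} (hε : 0 < ε) {b : ℝ} (hb : b ≠ 0) (hb2 : -2 ≤ b) (x y : Eu N) :
    lap (fun y => kern b ε x y) y ≤ -((N - b - 2) * qq ε x y ^ (-((b + 2) / 2))) := by
  have hq := qq_pos hε x y
  have h : qq ε x y ^ (-((b + 2) / 2)) = qq ε x y ^ (-b / 2 - 2) * qq ε x y := by
    rw [← Real.rpow_add_one hq.ne']; congr 1; ring
  rw [lap_kern hε hb, h]
  have hp : 0 < qq ε x y ^ (-b / 2 - 2) := by positivity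
  have : 0 ≤ qq ε x y ^ (-b / 2 - 2) * ((b + 2) * ε ^ 2) :=
    mul_nonneg hp.le (mul_nonneg (by linarith) (sq_nonneg _))
  have e : qq ε x y = ‖y - x‖ ^ 2 + ε ^ 2 := rfl
  nth_rewrite 3 [e]
  linarith

/-- Localised super-harmonicity of the regularised Riesz kernels. -/
lemma lap_cutoff_kern_le {N : ℕ} {r A : ℝ} {n : ℕ} {χ : Eu N → ℝ} (hχ : IsCutoff r n A χ)
    (hn : 2 * N ≤ n) {b : ℝ} (hb : b ≠ 0) (hb2 : -2 ≤ b) (hbN : b < N - 2) (Q : ℝ) :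
    ∃ C : ℝ, 0 ≤ C ∧ ∀ ε : ℝ, 0 < ε → ∀ x y : Eu N, qq ε x y ≤ Q →
      lap (fun y => χ y ^ (n + 2) * kern b ε x y) y ≤
        -((N - b - 2) / 2 * (χ y ^ (n + 2) * qq ε x y ^ (-((b + 2) / 2)))) + C := by
  obtain ⟨C, hC, h⟩ := cross_bound hχ hn hb (c := b + 2) (η := (N - b - 2) / 2)
    (by linarith) (by linarith) (by linarith) Q
  refine ⟨C, hC, fun ε hε x y hQ => ?_⟩
  have h1 := (abs_le.1 (h ε hε x y hQ)).2
  have h2 := mul_le_mul_of_nonneg_left (lap_kern_le hε hb hb2 x y)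
    (pow_nonneg (hχ.nonneg y) (n + 2))
  linarith

/-- The Newtonian kernel corrected by a slightly less singular Riesz kernel. -/
def kerN {N : ℕ} (σ ε : ℝ) (x y : Eu N) : ℝ := kern (N - 2) ε x y + kern (N - 2 - σ) ε x y

lemma lap_cutoff_kerN_le {N : ℕ} (hN : 3 ≤ N) {r A : ℝ} {n : ℕ} {χ : Eu N → ℝ}
    (hχ : IsCutoff r n A χ) (hn : 2 * N ≤ n) {σ : ℝ} (hσ : 0 < σ) (hσ' : σ ≤ 1 / 2) (Q : ℝ) :
    ∃ C : ℝ, 0 ≤ C ∧ ∀ ε : ℝ, 0 < ε → ∀ x y : Eu N, qq ε x y ≤ Q →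
      lap (fun y => χ y ^ (n + 2) * kerN σ ε x y) y ≤
        -(χ y ^ (n + 2) * (N * ε ^ 2 * qq ε x y ^ (-(N : ℝ) / 2 - 1))) + C := by
  have hN' : (3 : ℝ) ≤ N := by exact_mod_cast hN
  have b1 : (N : ℝ) - 2 ≠ 0 := by linarith
  have b2 : (N : ℝ) - 2 - σ ≠ 0 := by linarith
  obtain ⟨C₁, hC₁, h₁⟩ := cross_bound hχ hn b1 (c := N - σ) (η := σ / 2)
    (by linarith) (by linarith) (by linarith) Q
  obtain ⟨C₂, hC₂, h₂⟩ := cross_bound hχ hn b2 (c := N - σ) (η := σ / 2)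
    (by linarith) (by linarith) (by linarith) Q
  refine ⟨C₁ + C₂, by positivity, fun ε hε x y hQ => ?_⟩
  have e : (fun y => χ y ^ (n + 2) * kerN σ ε x y) = fun y =>
      χ y ^ (n + 2) * kern (N - 2) ε x y + χ y ^ (n + 2) * kern (N - 2 - σ) ε x y := by
    ext y; rw [kerN]; ring
  have hz := hχ.smooth.pow (n + 2)
  rw [e, lap_add (hz.mul (contDiff_kern hε _ x)) (hz.mul (contDiff_kern hε _ x))]
  have k1 := (abs_le.1 (h₁ ε hε x y hQ)).2
  have k2 := (abs_le.1 (h₂ ε hε x y hQ)).2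
  have k3 := mul_le_mul_of_nonneg_left (lap_kern_le hε b2 (by linarith) x y)
    (pow_nonneg (hχ.nonneg y) (n + 2))
  have k4 := lap_kern hε b1 x y
  rw [show (N : ℝ) - (N - 2) - 2 = 0 by ring, zero_mul, zero_add,
    show -((N : ℝ) - 2) / 2 - 2 = -(N : ℝ) / 2 - 1 by ring] at k4
  rw [k4] at k1
  rw [show (N : ℝ) - 2 - σ + 2 = N - σ by ring, show (N : ℝ) - (N - 2 - σ) - 2 = σ by ring] at k3
  linarith

/-- The weak identity `∂ₜ f = Δ w` tested against products, together with the pointwise control of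
`f` by `w`. -/
structure WeakData {N : ℕ} (f w : Eu N × ℝ → ℝ) (r α₀ β₀ γ Cu : ℝ) : Prop where
  measf : Measurable f
  measw : Measurable w
  f_nonneg : ∀ p, 0 ≤ f p
  w_nonneg : ∀ p, 0 ≤ w p
  intf : Integrable f
  intw : Integrable w
  weak : ∀ (G : Eu N → ℝ) (a : ℝ → ℝ), ContDiff ℝ (⊤ : ℕ∞) G → ContDiff ℝ (⊤ : ℕ∞) a →
    (∀ y, r < ‖y‖ → G y = 0) → (∀ t, t ∉ Icc α₀ β₀ → a t = 0) →
    ∫ p, (f p * (G p.1 * deriv a p.2) + w p * (a p.2 * lap G p.1)) = 0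
  Cu_nonneg : 0 ≤ Cu
  bound : ∀ᵐ p, f p ≤ Cu * ‖p.1‖ ^ (-γ) * (1 + w p)

lemma lap_eq_zero {N : ℕ} {G : Eu N → ℝ} {r : ℝ} (h : ∀ y, r < ‖y‖ → G y = 0) {y : Eu N}
    (hy : r < ‖y‖) : lap G y = 0 := by
  have ho : ∀ z : Eu N, r < ‖z‖ → ∀ᶠ z' in 𝓝 z, r < ‖z'‖ := fun z hz =>
    (isOpen_lt continuous_const continuous_norm).mem_nhds hz
  have h1 : ∀ z : Eu N, r < ‖z‖ → ∀ v, fderiv ℝ G z v = 0 := by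
    intro z hz v
    have : G =ᶠ[𝓝 z] fun _ => 0 := by
      filter_upwards [ho z hz] with z' hz' using h z' hz'
    rw [this.fderiv_eq]; simp
  refine Finset.sum_eq_zero fun i _ => ?_
  have : (fun q => fderiv ℝ G q (ee i)) =ᶠ[𝓝 y] fun _ => 0 := by
    filter_upwards [ho y hy] with z' hz' using h1 z' hz' _
  rw [this.fderiv_eq]; simp

lemma exists_bound_of_zero_outside_ball {N : ℕ} {G : Eu N → ℝ} (hG : Continuous G) {r : ℝ}
    (h : ∀ y, r < ‖y‖ → G y = 0) : ∃ C, ∀ y, |G y| ≤ C :=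
  (HasCompactSupport.intro (isCompact_closedBall (0 : Eu N) r) fun y hy =>
    h y (by simpa using hy)).exists_bound_of_continuous hG

lemma deriv_eq_zero_outside_Icc {a : ℝ → ℝ} {α β : ℝ} (h : ∀ t, t ∉ Icc α β → a t = 0) {t : ℝ}
    (ht : t ∉ Icc α β) : deriv a t = 0 := by
  have : a =ᶠ[𝓝 t] fun _ => 0 := by
    filter_upwards [isClosed_Icc.isOpen_compl.mem_nhds ht] with s hs using h s hs
  rw [this.deriv_eq]; simp

lemma exists_bound_of_zero_outside_Icc {a : ℝ → ℝ} (ha : Continuous a) {α β : ℝ}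
    (h : ∀ t, t ∉ Icc α β → a t = 0) : ∃ C, ∀ t, |a t| ≤ C :=
  (HasCompactSupport.intro isCompact_Icc h).exists_bound_of_continuous ha

lemma integrable_mul_of_bound {α : Type*} [MeasurableSpace α] {μ : Measure α} {f k : α → ℝ}
    (hf : Integrable f μ) (hk : Measurable k) {C : ℝ} (h : ∀ p, |k p| ≤ C) :
    Integrable (fun p => f p * k p) μ :=
  hf.mul_bdd hk.aestronglyMeasurable (ae_of_all _ h)

lemma WeakData.tensor {N : ℕ} {f w : Eu N × ℝ → ℝ} {r α₀ β₀ γ Cu : ℝ}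
    (h : WeakData f w r α₀ β₀ γ Cu) {G : Eu N → ℝ} {a : ℝ → ℝ} (hG : ContDiff ℝ (⊤ : ℕ∞) G)
    (ha : ContDiff ℝ (⊤ : ℕ∞) a) (hG0 : ∀ y, r < ‖y‖ → G y = 0)
    (ha0 : ∀ t, t ∉ Icc α₀ β₀ → a t = 0) :
    Integrable (fun p => f p * (G p.1 * deriv a p.2)) ∧
    Integrable (fun p => w p * (a p.2 * -lap G p.1)) ∧
    ∫ p, w p * (a p.2 * -lap G p.1) = ∫ p, f p * (G p.1 * deriv a p.2) := by
  have hda : Continuous (deriv a) := ha.continuous_deriv (by simp)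
  have hlG := continuous_lap hG
  obtain ⟨C₁, h₁⟩ := exists_bound_of_zero_outside_ball hG.continuous hG0
  obtain ⟨C₂, h₂⟩ := exists_bound_of_zero_outside_ball hlG fun y => lap_eq_zero hG0
  obtain ⟨C₃, h₃⟩ := exists_bound_of_zero_outside_Icc ha.continuous ha0
  obtain ⟨C₄, h₄⟩ := exists_bound_of_zero_outside_Icc hda fun t => deriv_eq_zero_outside_Icc ha0
  have i1 : Integrable (fun p => f p * (G p.1 * deriv a p.2)) := by
    refine integrable_mul_of_bound h.intf (C := C₁ * C₄) (Continuous.measurable ?_) fun p => ?_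
    · have := hG.continuous
      fun_prop
    · rw [abs_mul]
      exact mul_le_mul (h₁ _) (h₄ _) (abs_nonneg _) ((abs_nonneg _).trans (h₁ p.1))
  have i2 : Integrable (fun p => w p * (a p.2 * -lap G p.1)) := by
    refine integrable_mul_of_bound h.intw (C := C₃ * C₂) (Continuous.measurable ?_) fun p => ?_
    · have := ha.continuous
      fun_prop
    · rw [abs_mul, abs_neg]
      exact mul_le_mul (h₃ _) (h₂ _) (abs_nonneg _) ((abs_nonneg _).trans (h₃ p.2))
  refine ⟨i1, i2, ?_⟩
  have := h.weak G a hG ha hG0 ha0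
  have e : ∀ p : Eu N × ℝ, f p * (G p.1 * deriv a p.2) + w p * (a p.2 * lap G p.1) =
    f p * (G p.1 * deriv a p.2) - w p * (a p.2 * -lap G p.1) := fun p => by ring
  simp only [e] at this
  rw [integral_sub i1 i2] at this
  linarith

lemma exists_time_cutoff {α β δ : ℝ} (h : α ≤ β) (hδ : 0 < δ) :
    ∃ (φ : ℝ → ℝ) (M : ℝ), ContDiff ℝ (⊤ : ℕ∞) φ ∧ (∀ t, 0 ≤ φ t) ∧ (∀ t, φ t ≤ 1) ∧
      (∀ t ∈ Icc α β, φ t = 1) ∧ (∀ t, t ∉ Icc (α - δ) (β + δ) → φ t = 0) ∧ 0 ≤ M ∧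
      ∀ t, |deriv φ t| ≤ M := by
  let φ : ContDiffBump ((α + β) / 2) := ⟨(β - α) / 2 + δ / 2, (β - α) / 2 + δ, by linarith,
    by linarith⟩
  have hs : ContDiff ℝ (⊤ : ℕ∞) (fun t => φ t) := φ.contDiff
  have h0 : ∀ t, t ∉ Icc (α - δ) (β + δ) → φ t = 0 := by
    intro t ht
    refine φ.zero_of_le_dist ?_
    rw [Real.dist_eq, le_abs]
    rw [mem_Icc, not_and_or, not_le, not_le] at ht
    change (β - α) / 2 + δ ≤ _ ∨ (β - α) / 2 + δ ≤ _
    rcases ht with ht | ht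
    · right; linarith
    · left; linarith
  obtain ⟨M, hM⟩ := exists_bound_of_zero_outside_Icc (hs.continuous_deriv (by simp)) fun t =>
    deriv_eq_zero_outside_Icc h0
  refine ⟨fun t => φ t, M, hs, fun t => φ.nonneg, fun t => φ.le_one, ?_, h0,
    (abs_nonneg _).trans (hM 0), hM⟩
  intro t ht
  refine φ.one_of_mem_closedBall ?_
  rw [mem_closedBall, Real.dist_eq, abs_le]
  change -((β - α) / 2 + δ / 2) ≤ _ ∧ _ ≤ (β - α) / 2 + δ / 2
  constructor <;> linarith [ht.1, ht.2]

lemma qq_le {N : ℕ} {r ε : ℝ} (hε : 0 < ε) (hε1 : ε ≤ 1) {x y : Eu N} (hx : ‖x‖ ≤ r)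
    (hy : ‖y‖ ≤ r) : qq ε x y ≤ 4 * r ^ 2 + 1 := by
  have h1 : ‖y - x‖ ≤ 2 * r := (norm_sub_le _ _).trans (by linarith)
  have h2 : ‖y - x‖ ^ 2 ≤ (2 * r) ^ 2 := by gcongr
  have h3 : ε ^ 2 ≤ 1 := pow_le_one₀ hε.le hε1
  unfold qq; linarith

/-- The part of space-time lying in a time window. -/
def win (N : ℕ) (α β : ℝ) : Set (Eu N × ℝ) := univ ×ˢ Icc α β

lemma measurableSet_win (N : ℕ) (α β : ℝ) : MeasurableSet (win N α β) :=
  MeasurableSet.univ.prod measurableSet_Icc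

lemma mem_win {N : ℕ} {α β : ℝ} {p : Eu N × ℝ} : p ∈ win N α β ↔ p.2 ∈ Icc α β := by
  simp [win]

/-- Uniform bounds for Riesz potentials of `w` in interior time windows. -/
def SBound {N : ℕ} (ζ : Eu N → ℝ) (w : Eu N × ℝ → ℝ) (α₀ β₀ r c : ℝ) : Prop :=
  ∀ α β, α₀ < α → α ≤ β → β < β₀ → ∃ C : ℝ≥0∞, C < ⊤ ∧ ∀ x : Eu N, ‖x‖ ≤ r →
    ∫⁻ p in win N α β, ENNReal.ofReal (w p * (ζ p.1 * ‖p.1 - x‖ ^ (-c))) ≤ C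

/-- Uniform bounds for regularised Riesz potentials of `f` in interior time windows. -/
def FBound {N : ℕ} (ζ : Eu N → ℝ) (f : Eu N × ℝ → ℝ) (α₀ β₀ r b : ℝ) : Prop :=
  ∀ α β, α₀ < α → α ≤ β → β < β₀ → ∃ C : ℝ≥0∞, C < ⊤ ∧ ∀ (x : Eu N) (ε : ℝ), ‖x‖ ≤ r →
    0 < ε → ε ≤ 1 →
    ∫⁻ p in win N α β, ENNReal.ofReal (f p * (ζ p.1 * qq ε x p.1 ^ (-b / 2))) ≤ C

lemma IsCutoff.pow_nonneg' {N n : ℕ} {r A : ℝ} {χ : Eu N → ℝ} (hχ : IsCutoff r n A χ) (y : Eu N) :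
    0 ≤ χ y ^ (n + 2) := pow_nonneg (hχ.nonneg y) _

lemma IsCutoff.pow_le_one' {N n : ℕ} {r A : ℝ} {χ : Eu N → ℝ} (hχ : IsCutoff r n A χ) (y : Eu N) :
    χ y ^ (n + 2) ≤ 1 := pow_le_one₀ (hχ.nonneg y) (hχ.le_one y)

lemma IsCutoff.pow_eq_zero {N n : ℕ} {r A : ℝ} {χ : Eu N → ℝ} (hχ : IsCutoff r n A χ) {y : Eu N}
    (hy : r < ‖y‖) : χ y ^ (n + 2) = 0 := by
  rw [hχ.zero y hy]; simp

lemma lap_cutoff_kern_le_everywhere {N : ℕ} {r A : ℝ} {n : ℕ} {χ : Eu N → ℝ}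
    (hχ : IsCutoff r n A χ) (hn : 2 * N ≤ n) {b : ℝ} (hb : b ≠ 0) (hb2 : -2 ≤ b)
    (hbN : b < N - 2) :
    ∃ C : ℝ, 0 ≤ C ∧ ∀ ε : ℝ, 0 < ε → ε ≤ 1 → ∀ x y : Eu N, ‖x‖ ≤ r →
      lap (fun y => χ y ^ (n + 2) * kern b ε x y) y ≤
        -((N - b - 2) / 2 * (χ y ^ (n + 2) * qq ε x y ^ (-(b + 2) / 2))) + C := by
  obtain ⟨C, hC, h⟩ := lap_cutoff_kern_le hχ hn hb hb2 hbN (4 * r ^ 2 + 1)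
  refine ⟨C, hC, fun ε hε hε1 x y hx => ?_⟩
  rcases le_or_gt ‖y‖ r with hy | hy
  · have := h ε hε x y (qq_le hε hε1 hx hy)
    rwa [← neg_div] at this
  · rw [lap_eq_zero (r := r) (fun z hz => by rw [hχ.pow_eq_zero hz, zero_mul]) hy,
      hχ.pow_eq_zero hy]
    simpa using hC

lemma IsCutoff.continuous_mul_qq {N n : ℕ} {r A : ℝ} {χ : Eu N → ℝ} (hχ : IsCutoff r n A χ) {ε : ℝ}
    (hε : 0 < ε) (x : Eu N) (s : ℝ) : Continuous (fun y => χ y ^ (n + 2) * qq ε x y ^ s) :=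
  (hχ.smooth.continuous.pow _).mul (contDiff_qq_rpow hε s x).continuous

lemma IsCutoff.mul_qq_bound {N n : ℕ} {r A : ℝ} {χ : Eu N → ℝ} (hχ : IsCutoff r n A χ) {ε : ℝ}
    (hε : 0 < ε) (x : Eu N) (s : ℝ) : ∃ C, ∀ y, |χ y ^ (n + 2) * qq ε x y ^ s| ≤ C :=
  exists_bound_of_zero_outside_ball (r := r)
    (hχ.continuous_mul_qq hε x s) fun y hy => by rw [hχ.pow_eq_zero hy, zero_mul]

lemma lintegral_ofReal_le_of_liminf {α : Type*} [MeasurableSpace α] {μ : Measure α}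
    {F : ℕ → α → ℝ} {G : α → ℝ} (hF : ∀ n, AEMeasurable (F n) μ)
    (hG : ∀ᵐ p ∂μ, ∃ l, G p ≤ l ∧ (Tendsto (fun n => F n p) atTop (𝓝 l) ∨ l ≤ 0)) {C : ℝ≥0∞}
    (h : ∀ n, ∫⁻ p, ENNReal.ofReal (F n p) ∂μ ≤ C) : ∫⁻ p, ENNReal.ofReal (G p) ∂μ ≤ C := by
  calc ∫⁻ p, ENNReal.ofReal (G p) ∂μ
      ≤ ∫⁻ p, liminf (fun n => ENNReal.ofReal (F n p)) atTop ∂μ := by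
        refine lintegral_mono_ae ?_
        filter_upwards [hG] with p hp
        obtain ⟨l, hl, h1 | h1⟩ := hp
        · have h2 : Tendsto (fun n => ENNReal.ofReal (F n p)) atTop (𝓝 (ENNReal.ofReal l)) :=
            (ENNReal.continuous_ofReal.tendsto _).comp h1
          rw [h2.liminf_eq]
          exact ENNReal.ofReal_le_ofReal hl
        · rw [ENNReal.ofReal_of_nonpos (hl.trans h1)]
          exact zero_le
    _ ≤ liminf (fun n => ∫⁻ p, ENNReal.ofReal (F n p) ∂μ) atTop :=
        lintegral_liminf_le' fun n => (hF n).ennreal_ofReal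
    _ ≤ C := by
        refine liminf_le_of_frequently_le' ?_
        exact Frequently.of_forall h

lemma SBound.of_FBound {N n : ℕ} {f w : Eu N × ℝ → ℝ} {r α₀ β₀ γ Cu A : ℝ} {χ : Eu N → ℝ}
    (h : WeakData f w r α₀ β₀ γ Cu) (hχ : IsCutoff r n A χ) (hn : 2 * N ≤ n) {b : ℝ}
    (hb : b ≠ 0) (hb2 : -2 ≤ b) (hbN : b < N - 2)
    (hF : FBound (fun y => χ y ^ (n + 2)) f α₀ β₀ r b) :
    SBound (fun y => χ y ^ (n + 2)) w α₀ β₀ r (b + 2) := by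
  intro α β hα hαβ hβ
  obtain ⟨δ, hδ, hδ1, hδ2⟩ : ∃ δ, 0 < δ ∧ α₀ < α - δ ∧ β + δ < β₀ :=
    ⟨min (α - α₀) (β₀ - β) / 2, by
      have := lt_min (sub_pos.2 hα) (sub_pos.2 hβ); linarith, by
      have := min_le_left (α - α₀) (β₀ - β); linarith, by
      have := min_le_right (α - α₀) (β₀ - β); linarith⟩
  obtain ⟨φ, M, φs, φ0, φ1, φe, φz, hM, φd⟩ := exists_time_cutoff hαβ hδ
  obtain ⟨C₀, hC₀, hF⟩ := hF (α - δ) (β + δ) hδ1 (by linarith) hδ2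
  obtain ⟨C₁, hC₁, hL⟩ := lap_cutoff_kern_le_everywhere hχ hn hb hb2 hbN
  set c : ℝ := (N - b - 2) / 2 with hc
  have hc0 : 0 < c := by rw [hc]; linarith
  have φz' : ∀ t, t ∉ Icc α₀ β₀ → φ t = 0 := fun t ht => φz t fun h' =>
    ht ⟨by linarith [h'.1], by linarith [h'.2]⟩
  have hreg : ∀ (x : Eu N) (ε : ℝ), ‖x‖ ≤ r → 0 < ε → ε ≤ 1 →
      ∫⁻ p in win N α β, ENNReal.ofReal (w p * (χ p.1 ^ (n + 2) * qq ε x p.1 ^ (-(b + 2) / 2))) ≤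
        ENNReal.ofReal ((C₁ * ∫ p, w p) / c) + ENNReal.ofReal (M / |b| / c) * C₀ := by
    intro x ε hx hε hε1
    have hq := fun y => qq_pos hε x y
    have Gs : ContDiff ℝ (⊤ : ℕ∞) (fun y => χ y ^ (n + 2) * kern b ε x y) :=
      (hχ.smooth.pow _).mul (contDiff_kern hε _ x)
    obtain ⟨i1, i2, he⟩ := h.tensor Gs φs (fun y hy => by rw [hχ.pow_eq_zero hy, zero_mul]) φz'
    obtain ⟨B, hB⟩ := hχ.mul_qq_bound hε x (-(b + 2) / 2)
    have hφc := φs.continuous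
    have i3 : Integrable (fun p : Eu N × ℝ =>
        w p * (φ p.2 * (χ p.1 ^ (n + 2) * qq ε x p.1 ^ (-(b + 2) / 2)))) := by
      refine integrable_mul_of_bound h.intw (C := B) (Continuous.measurable ?_) fun p => ?_
      · exact (hφc.comp continuous_snd).mul
          ((hχ.continuous_mul_qq hε x _).comp continuous_fst)
      · rw [abs_mul, abs_of_nonneg (φ0 _)]
        exact (mul_le_of_le_one_left (abs_nonneg _) (φ1 _)).trans (hB _)
    have k1 : c * ∫ p : Eu N × ℝ, w p * (φ p.2 * (χ p.1 ^ (n + 2) * qq ε x p.1 ^ (-(b + 2) / 2))) ≤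
        (C₁ * ∫ p, w p) +
          ∫ p : Eu N × ℝ, f p * ((χ p.1 ^ (n + 2) * kern b ε x p.1) * deriv φ p.2) := by
      rw [← he, ← integral_const_mul, ← integral_const_mul,
        ← integral_add (h.intw.const_mul _) i2]
      refine integral_mono (i3.const_mul _) ((h.intw.const_mul _).add i2) fun p => ?_
      have h1 := hL ε hε hε1 x p.1 hx
      have h2 := mul_le_mul_of_nonneg_left h1 (mul_nonneg (h.w_nonneg p) (φ0 p.2))
      have h3 : w p * φ p.2 * C₁ ≤ w p * C₁ := by
        have := h.w_nonneg p
        gcongr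
        exact mul_le_of_le_one_right this (φ1 _)
      simp only
      linarith
    have k2 : ENNReal.ofReal (∫ p : Eu N × ℝ,
        f p * ((χ p.1 ^ (n + 2) * kern b ε x p.1) * deriv φ p.2)) ≤
        ENNReal.ofReal (M / |b|) * C₀ := by
      calc _ ≤ ENNReal.ofReal (∫ p : Eu N × ℝ,
            |f p * ((χ p.1 ^ (n + 2) * kern b ε x p.1) * deriv φ p.2)|) :=
            ENNReal.ofReal_le_ofReal (integral_mono i1 i1.abs fun p => le_abs_self _)
        _ = ∫⁻ p : Eu N × ℝ, ENNReal.ofReal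
            |f p * ((χ p.1 ^ (n + 2) * kern b ε x p.1) * deriv φ p.2)| :=
            ofReal_integral_eq_lintegral_ofReal i1.abs (ae_of_all _ fun p => abs_nonneg _)
        _ ≤ ∫⁻ p in win N (α - δ) (β + δ), ENNReal.ofReal (M / |b|) *
              ENNReal.ofReal (f p * (χ p.1 ^ (n + 2) * qq ε x p.1 ^ (-b / 2))) := by
            rw [← lintegral_indicator (measurableSet_win _ _ _)]
            refine lintegral_mono fun p => ?_
            by_cases hp : p ∈ win N (α - δ) (β + δ)
            · rw [indicator_of_mem hp, ← ENNReal.ofReal_mul (by positivity)]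
              refine ENNReal.ofReal_le_ofReal ?_
              simp only [abs_mul, kern, abs_div, abs_of_nonneg (h.f_nonneg p),
                abs_of_nonneg (hχ.pow_nonneg' p.1), abs_of_pos (Real.rpow_pos_of_pos (hq p.1) _)]
              have e1 := h.f_nonneg p
              have e2 := hχ.pow_nonneg' p.1
              have e3 := (Real.rpow_pos_of_pos (hq p.1) (-b / 2)).le
              calc f p * (χ p.1 ^ (n + 2) * (qq ε x p.1 ^ (-b / 2) / |b|) * |deriv φ p.2|)
                  ≤ f p * (χ p.1 ^ (n + 2) * (qq ε x p.1 ^ (-b / 2) / |b|) * M) := by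
                    gcongr
                    exact φd _
                _ = _ := by ring
            · rw [indicator_of_notMem hp, deriv_eq_zero_outside_Icc φz (by rwa [mem_win] at hp)]
              simp
        _ = ENNReal.ofReal (M / |b|) * ∫⁻ p in win N (α - δ) (β + δ),
              ENNReal.ofReal (f p * (χ p.1 ^ (n + 2) * qq ε x p.1 ^ (-b / 2))) :=
            lintegral_const_mul' _ _ ENNReal.ofReal_ne_top
        _ ≤ _ := by gcongr; exact hF x ε hx hε hε1
    have hw0 : 0 ≤ C₁ * ∫ p, w p := mul_nonneg hC₁ (integral_nonneg h.w_nonneg)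
    calc _ ≤ ∫⁻ p : Eu N × ℝ, ENNReal.ofReal
          (w p * (φ p.2 * (χ p.1 ^ (n + 2) * qq ε x p.1 ^ (-(b + 2) / 2)))) := by
          rw [← lintegral_indicator (measurableSet_win _ _ _)]
          refine lintegral_mono fun p => ?_
          by_cases hp : p ∈ win N α β
          · rw [indicator_of_mem hp, φe _ (by rwa [mem_win] at hp), one_mul]
          · rw [indicator_of_notMem hp]; exact zero_le
      _ = ENNReal.ofReal (∫ p : Eu N × ℝ,
            w p * (φ p.2 * (χ p.1 ^ (n + 2) * qq ε x p.1 ^ (-(b + 2) / 2)))) := by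
          refine (ofReal_integral_eq_lintegral_ofReal i3 (ae_of_all _ fun p => ?_)).symm
          exact mul_nonneg (h.w_nonneg p) (mul_nonneg (φ0 _) (mul_nonneg (hχ.pow_nonneg' _)
            (Real.rpow_pos_of_pos (hq p.1) _).le))
      _ ≤ ENNReal.ofReal ((C₁ * ∫ p, w p) / c + (∫ p : Eu N × ℝ,
            f p * ((χ p.1 ^ (n + 2) * kern b ε x p.1) * deriv φ p.2)) / c) := by
          refine ENNReal.ofReal_le_ofReal ?_
          rw [← add_div, le_div_iff₀ hc0]
          linarith
      _ ≤ ENNReal.ofReal ((C₁ * ∫ p, w p) / c) + ENNReal.ofReal ((∫ p : Eu N × ℝ,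
            f p * ((χ p.1 ^ (n + 2) * kern b ε x p.1) * deriv φ p.2)) / c) := ENNReal.ofReal_add_le
      _ ≤ _ := by
          gcongr
          rw [div_eq_inv_mul, ENNReal.ofReal_mul (by positivity), div_eq_inv_mul (M / |b|),
            ENNReal.ofReal_mul (by positivity), mul_assoc]
          gcongr
  refine ⟨ENNReal.ofReal ((C₁ * ∫ p, w p) / c) + ENNReal.ofReal (M / |b| / c) * C₀,
    ENNReal.add_lt_top.2 ⟨ENNReal.ofReal_lt_top, ENNReal.mul_lt_top ENNReal.ofReal_lt_top hC₀⟩,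
    fun x hx => ?_⟩
  have hε : ∀ k : ℕ, 0 < 1 / ((k : ℝ) + 1) := fun k => by positivity
  refine lintegral_ofReal_le_of_liminf (F := fun k p => w p * (χ p.1 ^ (n + 2) *
    qq (1 / ((k : ℝ) + 1)) x p.1 ^ (-(b + 2) / 2))) (fun k => ?_) (ae_of_all _ fun p => ?_) fun k =>
    hreg x _ hx (hε k) (by
      rw [div_le_one (by positivity)]
      have : (0 : ℝ) ≤ k := by positivity
      linarith)
  · exact (h.measw.mul
      ((hχ.continuous_mul_qq (hε k) x _).comp continuous_fst).measurable).aemeasurable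
  · refine ⟨_, le_rfl, ?_⟩
    by_cases hp : p.1 = x
    · rcases eq_or_ne (b + 2) 0 with hb' | hb'
      · left
        simp [hb']
      · right
        rw [hp, sub_self, norm_zero, Real.zero_rpow (neg_ne_zero.2 hb')]
        simp
    · left
      have hn : 0 < ‖p.1 - x‖ := norm_pos_iff.2 (sub_ne_zero.2 hp)
      refine (Tendsto.const_mul _ ?_).const_mul _
      have h1 : Tendsto (fun k : ℕ => qq (1 / ((k : ℝ) + 1)) x p.1) atTop (𝓝 (‖p.1 - x‖ ^ 2)) := by
        have := ((tendsto_one_div_add_atTop_nhds_zero_nat (𝕜 := ℝ)).pow 2).const_add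
          (‖p.1 - x‖ ^ 2)
        simpa [qq] using this
      have h2 := h1.rpow_const (p := -(b + 2) / 2) (Or.inl (by positivity))
      rwa [← Real.rpow_natCast, ← Real.rpow_mul hn.le,
        show ((2 : ℕ) : ℝ) * (-(b + 2) / 2) = -(b + 2) by push_cast; ring] at h2

lemma FBound.of_nonpos {N n : ℕ} {f w : Eu N × ℝ → ℝ} {r α₀ β₀ γ Cu A : ℝ} {χ : Eu N → ℝ}
    (h : WeakData f w r α₀ β₀ γ Cu) (hχ : IsCutoff r n A χ) {b : ℝ} (hb : b ≤ 0) :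
    FBound (fun y => χ y ^ (n + 2)) f α₀ β₀ r b := by
  intro α β _ _ _
  refine ⟨ENNReal.ofReal (∫ p, f p * (4 * r ^ 2 + 1) ^ (-b / 2)), ENNReal.ofReal_lt_top,
    fun x ε hx hε hε1 => ?_⟩
  rw [ofReal_integral_eq_lintegral_ofReal (h.intf.mul_const _)
    (ae_of_all _ fun p => mul_nonneg (h.f_nonneg p) (by positivity))]
  refine (setLIntegral_le_lintegral _ _).trans (lintegral_mono fun p => ENNReal.ofReal_le_ofReal ?_)
  refine mul_le_mul_of_nonneg_left ?_ (h.f_nonneg p)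
  rcases le_or_gt ‖p.1‖ r with hp | hp
  · have h1 : qq ε x p.1 ^ (-b / 2) ≤ (4 * r ^ 2 + 1) ^ (-b / 2) :=
      Real.rpow_le_rpow (qq_pos hε _ _).le (qq_le hε hε1 hx hp) (by linarith)
    exact (mul_le_of_le_one_left (Real.rpow_pos_of_pos (qq_pos hε _ _) _).le
      (hχ.pow_le_one' _)).trans h1
  · simp only [hχ.pow_eq_zero hp, zero_mul]
    positivity

lemma exists_riesz_bound {N n : ℕ} (hN : 1 ≤ N) {r A : ℝ} {χ : Eu N → ℝ} (hχ : IsCutoff r n A χ)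
    {c : ℝ} (hc : c < N) (α β : ℝ) :
    ∃ C : ℝ≥0∞, C < ⊤ ∧ ∀ x : Eu N, ‖x‖ ≤ r →
      ∫⁻ p in win N α β, ENNReal.ofReal (χ p.1 ^ (n + 2) * ‖p.1 - x‖ ^ (-c)) ≤ C := by
  set F : Eu N → ℝ≥0∞ := fun z => (ball 0 (2 * r + 1)).indicator
    (fun z => ENNReal.ofReal (‖z‖ ^ (-c))) z with hF
  have hmeas : Measurable fun z : Eu N => ‖z‖ ^ (-c) := by fun_prop
  have hint : IntegrableOn (fun z : Eu N => ‖z‖ ^ (-c)) (ball 0 (2 * r + 1)) := by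
    refine integrableOn_ball_of_norm_le_rpow (C := 1) (α := c) (by simpa using hN)
      (by simpa using hc) (ae_of_all _ fun z => ?_) hmeas.aestronglyMeasurable
    rw [one_mul, Real.norm_of_nonneg (by positivity)]
  have hfin : ∫⁻ z, F z < ⊤ := by
    rw [hF, lintegral_indicator measurableSet_ball]
    have := hint.2
    rw [hasFiniteIntegral_iff_ofReal (ae_of_all _ fun z => by positivity)] at this
    exact this
  have hFm : Measurable F := hmeas.ennreal_ofReal.indicator measurableSet_ball
  refine ⟨(∫⁻ z, F z) * volume (Icc α β), ENNReal.mul_lt_top hfin (by simp), fun x hx => ?_⟩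
  rw [← lintegral_sub_right_eq_self F x, ← setLIntegral_one, ← lintegral_prod_mul
    (f := fun y => F (y - x)) (g := fun _ => 1)
    ((hFm.comp (measurable_id.sub_const x)).aemeasurable) aemeasurable_const]
  have : ((volume : Measure (Eu N)).prod (volume.restrict (Icc α β))) =
      volume.restrict (win N α β) := by
    rw [win, Measure.volume_eq_prod, ← Measure.prod_restrict, Measure.restrict_univ]
  rw [this]
  refine lintegral_mono fun p => ?_
  rw [mul_one]
  rcases le_or_gt ‖p.1‖ r with hp | hp
  · have h1 : p.1 - x ∈ ball (0 : Eu N) (2 * r + 1) := by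
      rw [mem_ball_zero_iff]
      exact (norm_sub_le _ _).trans_lt (by linarith)
    rw [hF]
    simp only [indicator_of_mem h1]
    exact ENNReal.ofReal_le_ofReal (mul_le_of_le_one_left (by positivity) (hχ.pow_le_one' _))
  · simp only [hχ.pow_eq_zero hp, zero_mul, ENNReal.ofReal_zero]
    exact zero_le

lemma rpow_mul_rpow_le {a d γ b : ℝ} (ha : 0 < a) (hd : 0 < d) (hγ : 0 ≤ γ) (hb : 0 ≤ b) :
    a ^ (-γ) * d ^ (-b) ≤ a ^ (-(b + γ)) + d ^ (-(b + γ)) := by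
  rcases le_total a d with h | h
  · have : d ^ (-b) ≤ a ^ (-b) := Real.rpow_le_rpow_of_nonpos ha h (by linarith)
    calc a ^ (-γ) * d ^ (-b) ≤ a ^ (-γ) * a ^ (-b) := by gcongr
      _ = a ^ (-(b + γ)) := by rw [← Real.rpow_add ha]; congr 1; ring
      _ ≤ _ := le_add_of_nonneg_right (by positivity)
  · have : a ^ (-γ) ≤ d ^ (-γ) := Real.rpow_le_rpow_of_nonpos hd h (by linarith)
    calc a ^ (-γ) * d ^ (-b) ≤ d ^ (-γ) * d ^ (-b) := by gcongr
      _ = d ^ (-(b + γ)) := by rw [← Real.rpow_add hd]; congr 1; ring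
      _ ≤ _ := le_add_of_nonneg_left (by positivity)

lemma ae_fst_ne {N : ℕ} (hN : 1 ≤ N) (x : Eu N) : ∀ᵐ p : Eu N × ℝ, p.1 ≠ x := by
  have : Nonempty (Fin N) := ⟨⟨0, hN⟩⟩
  have h : ∀ᵐ y : Eu N, y ≠ x := by simp [ae_iff]
  rw [Measure.volume_eq_prod]
  exact Measure.quasiMeasurePreserving_fst.ae h

lemma FBound.of_SBound {N n : ℕ} (hN : 1 ≤ N) {f w : Eu N × ℝ → ℝ} {r α₀ β₀ γ Cu A : ℝ}
    {χ : Eu N → ℝ} (h : WeakData f w r α₀ β₀ γ Cu) (hr : 0 ≤ r) (hγ : 0 ≤ γ)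
    (hχ : IsCutoff r n A χ) {b : ℝ} (hb : 0 ≤ b) (hbN : b + γ < N)
    (hS : SBound (fun y => χ y ^ (n + 2)) w α₀ β₀ r (b + γ)) :
    FBound (fun y => χ y ^ (n + 2)) f α₀ β₀ r b := by
  intro α β hα hαβ hβ
  obtain ⟨C₁, hC₁, h₁⟩ := exists_riesz_bound hN hχ hbN α β
  obtain ⟨C₂, hC₂, h₂⟩ := hS α β hα hαβ hβ
  refine ⟨ENNReal.ofReal Cu * ((C₁ + C₂) + (C₁ + C₂)), ENNReal.mul_lt_top ENNReal.ofReal_lt_top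
    (by simp [hC₁, hC₂]), fun x ε hx hε hε1 => ?_⟩
  have hχm := hχ.smooth.continuous.measurable
  have hwm := h.measw
  have m1 : ∀ z : Eu N, Measurable fun p : Eu N × ℝ =>
      ENNReal.ofReal (χ p.1 ^ (n + 2) * ‖p.1 - z‖ ^ (-(b + γ))) := fun z => by fun_prop
  have m2 : ∀ z : Eu N, Measurable fun p : Eu N × ℝ =>
      ENNReal.ofReal (w p * (χ p.1 ^ (n + 2) * ‖p.1 - z‖ ^ (-(b + γ)))) := fun z => by fun_prop
  have m3 : ∀ z : Eu N, Measurable fun p : Eu N × ℝ =>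
      ENNReal.ofReal (χ p.1 ^ (n + 2) * ‖p.1 - z‖ ^ (-(b + γ))) +
      ENNReal.ofReal (w p * (χ p.1 ^ (n + 2) * ‖p.1 - z‖ ^ (-(b + γ)))) :=
    fun z => (m1 z).add (m2 z)
  have key : ∀ z : Eu N, ‖z‖ ≤ r → ∫⁻ p in win N α β,
      (ENNReal.ofReal (χ p.1 ^ (n + 2) * ‖p.1 - z‖ ^ (-(b + γ))) +
       ENNReal.ofReal (w p * (χ p.1 ^ (n + 2) * ‖p.1 - z‖ ^ (-(b + γ))))) ≤ C₁ + C₂ := by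
    intro z hz
    rw [lintegral_add_left (m1 z)]
    exact add_le_add (h₁ z hz) (h₂ z hz)
  refine le_trans ?_ (mul_le_mul_right (add_le_add (key 0 (by simpa using hr)) (key x hx)) _)
  rw [← lintegral_add_left (m3 0), ← lintegral_const_mul' _ _ ENNReal.ofReal_ne_top]
  refine lintegral_mono_ae (ae_restrict_of_ae ?_)
  filter_upwards [h.bound, ae_fst_ne hN x, ae_fst_ne hN 0] with p hp hpx hp0
  have n1 : 0 < ‖p.1 - x‖ := norm_pos_iff.2 (sub_ne_zero.2 hpx)
  have n0 : 0 < ‖p.1‖ := norm_pos_iff.2 hp0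
  have hζ := hχ.pow_nonneg' (n := n) p.1
  have hw := h.w_nonneg p
  have hCu := h.Cu_nonneg
  have hq : qq ε x p.1 ^ (-b / 2) ≤ ‖p.1 - x‖ ^ (-b) := by
    have e : ‖p.1 - x‖ ^ (-b) = (‖p.1 - x‖ ^ 2) ^ (-b / 2) := by
      rw [← Real.rpow_natCast, ← Real.rpow_mul n1.le]; congr 1; push_cast; ring
    rw [e]
    refine Real.rpow_le_rpow_of_nonpos (by positivity) ?_ (by linarith)
    unfold qq
    linarith [sq_nonneg ε]
  have t0 : 0 ≤ χ p.1 ^ (n + 2) * ‖p.1 - 0‖ ^ (-(b + γ)) := by positivity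
  have t1 : 0 ≤ χ p.1 ^ (n + 2) * ‖p.1 - x‖ ^ (-(b + γ)) := by positivity
  rw [← ENNReal.ofReal_add t0 (by positivity), ← ENNReal.ofReal_add t1 (by positivity),
    ← ENNReal.ofReal_add (by positivity) (by positivity), ← ENNReal.ofReal_mul hCu]
  refine ENNReal.ofReal_le_ofReal ?_
  rw [sub_zero]
  calc f p * (χ p.1 ^ (n + 2) * qq ε x p.1 ^ (-b / 2))
      ≤ (Cu * ‖p.1‖ ^ (-γ) * (1 + w p)) * (χ p.1 ^ (n + 2) * ‖p.1 - x‖ ^ (-b)) := by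
        refine mul_le_mul hp (mul_le_mul_of_nonneg_left hq hζ) ?_ (by positivity)
        exact mul_nonneg hζ (Real.rpow_pos_of_pos (qq_pos hε _ _) _).le
    _ = Cu * (1 + w p) * χ p.1 ^ (n + 2) * (‖p.1‖ ^ (-γ) * ‖p.1 - x‖ ^ (-b)) := by ring
    _ ≤ Cu * (1 + w p) * χ p.1 ^ (n + 2) * (‖p.1‖ ^ (-(b + γ)) + ‖p.1 - x‖ ^ (-(b + γ))) := by
        gcongr
        exact rpow_mul_rpow_le n0 n1 hγ hb
    _ = _ := by ring

lemma SBound.mono {N n : ℕ} {f w : Eu N × ℝ → ℝ} {r α₀ β₀ γ Cu A : ℝ} {χ : Eu N → ℝ}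
    (h : WeakData f w r α₀ β₀ γ Cu) (hr : 0 ≤ r) (hχ : IsCutoff r n A χ) {c c' : ℝ} (hc' : 0 < c')
    (hcc : c' ≤ c) (hS : SBound (fun y => χ y ^ (n + 2)) w α₀ β₀ r c) :
    SBound (fun y => χ y ^ (n + 2)) w α₀ β₀ r c' := by
  intro α β hα hαβ hβ
  obtain ⟨C, hC, hS⟩ := hS α β hα hαβ hβ
  refine ⟨ENNReal.ofReal ((2 * r) ^ (c - c')) * C, ENNReal.mul_lt_top ENNReal.ofReal_lt_top hC,
    fun x hx => ?_⟩
  refine le_trans ?_ (mul_le_mul_right (hS x hx) _)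
  rw [← lintegral_const_mul' _ _ ENNReal.ofReal_ne_top]
  refine lintegral_mono fun p => ?_
  rw [← ENNReal.ofReal_mul (by positivity)]
  refine ENNReal.ofReal_le_ofReal ?_
  have hζ := hχ.pow_nonneg' (n := n) p.1
  have hw := h.w_nonneg p
  rcases le_or_gt ‖p.1‖ r with hp | hp
  · rcases eq_or_lt_of_le (norm_nonneg (p.1 - x)) with h0 | h0
    · simp only [← h0]
      rw [Real.zero_rpow (by linarith : -c' ≠ 0), mul_zero, mul_zero]
      have : (0 : ℝ) ≤ 0 ^ (-c) := Real.zero_rpow_nonneg _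
      positivity
    · have h1 : ‖p.1 - x‖ ≤ 2 * r := (norm_sub_le _ _).trans (by linarith)
      have h2 : ‖p.1 - x‖ ^ (c - c') ≤ (2 * r) ^ (c - c') :=
        Real.rpow_le_rpow h0.le h1 (by linarith)
      have h3 : ‖p.1 - x‖ ^ (-c') = ‖p.1 - x‖ ^ (c - c') * ‖p.1 - x‖ ^ (-c) := by
        rw [← Real.rpow_add h0]; congr 1; ring
      rw [h3]
      calc w p * (χ p.1 ^ (n + 2) * (‖p.1 - x‖ ^ (c - c') * ‖p.1 - x‖ ^ (-c)))
          ≤ w p * (χ p.1 ^ (n + 2) * ((2 * r) ^ (c - c') * ‖p.1 - x‖ ^ (-c))) := by gcongr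
        _ = _ := by ring
  · simp [hχ.pow_eq_zero hp]

/-- The moment bootstrap: all subcritical Riesz potentials of `w` are locally bounded. -/
lemma SBound.all {N n : ℕ} (hN : 3 ≤ N) {f w : Eu N × ℝ → ℝ} {r α₀ β₀ γ Cu A : ℝ} {χ : Eu N → ℝ}
    (h : WeakData f w r α₀ β₀ γ Cu) (hr : 0 ≤ r) (hγ : 0 ≤ γ) (hγ2 : γ < 2)
    (hχ : IsCutoff r n A χ) (hn : 2 * N ≤ n) {c : ℝ} (hc : 0 < c) (hcN : c < N) :
    SBound (fun y => χ y ^ (n + 2)) w α₀ β₀ r c := by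
  have hN' : (3 : ℝ) ≤ N := by exact_mod_cast hN
  have key : ∀ (k : ℕ) (c : ℝ), 0 < c → c < N → c < 2 + k * (2 - γ) →
      SBound (fun y => χ y ^ (n + 2)) w α₀ β₀ r c := by
    intro k
    induction k with
    | zero =>
      intro c hc hcN hck
      have := SBound.of_FBound h hχ hn (b := c - 2) (by push_cast at hck; linarith) (by linarith)
        (by linarith) (FBound.of_nonpos h hχ (by push_cast at hck; linarith))
      rwa [sub_add_cancel] at this
    | succ k ih =>
      have main : ∀ c : ℝ, 2 < c → c < N → c < 2 + (k + 1 : ℕ) * (2 - γ) →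
          SBound (fun y => χ y ^ (n + 2)) w α₀ β₀ r c := by
        intro c hc hcN hck
        push_cast at hck
        have := SBound.of_FBound h hχ hn (b := c - 2) (by linarith) (by linarith) (by linarith)
          (FBound.of_SBound (by omega) h hr hγ hχ (by linarith) (by linarith)
            (ih _ (by linarith) (by linarith) (by linarith)))
        rwa [sub_add_cancel] at this
      intro c hc hcN hck
      rcases lt_or_ge 2 c with h2 | h2
      · exact main c h2 hcN hck
      · have hk : (0 : ℝ) < (k + 1 : ℕ) * (2 - γ) := mul_pos (by positivity) (by linarith)
        set m := min ((k + 1 : ℕ) * (2 - γ)) 1 with hm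
        have hm0 : 0 < m := lt_min hk one_pos
        have hm1 : m ≤ 1 := min_le_right _ _
        have hm2 : m ≤ (k + 1 : ℕ) * (2 - γ) := min_le_left _ _
        exact (main (2 + m / 2) (by linarith) (by linarith) (by linarith)).mono h hr hχ hc
          (by linarith)
  obtain ⟨k, hk⟩ := exists_nat_gt (c / (2 - γ))
  rw [div_lt_iff₀ (by linarith)] at hk
  exact key k c hc hcN (by linarith)

lemma FBound.all {N n : ℕ} (hN : 3 ≤ N) {f w : Eu N × ℝ → ℝ} {r α₀ β₀ γ Cu A : ℝ} {χ : Eu N → ℝ}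
    (h : WeakData f w r α₀ β₀ γ Cu) (hr : 0 ≤ r) (hγ : 0 ≤ γ) (hγ2 : γ < 2)
    (hχ : IsCutoff r n A χ) (hn : 2 * N ≤ n) {b : ℝ} (hb : 0 < b) (hbN : b ≤ N - 2) :
    FBound (fun y => χ y ^ (n + 2)) f α₀ β₀ r b :=
  FBound.of_SBound (by omega) h hr hγ hχ hb.le (by linarith)
    (SBound.all hN h hr hγ hγ2 hχ hn (by linarith) (by linarith))

/-- An even mollifier at scale `δ`. -/
structure IsMollifier (δ : ℝ) (η : ℝ → ℝ) : Prop where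
  smooth : ContDiff ℝ (⊤ : ℕ∞) η
  nonneg : ∀ τ, 0 ≤ η τ
  even : ∀ τ, η (-τ) = η τ
  zero : ∀ τ, 2 * δ ≤ |τ| → η τ = 0
  integral : ∫ τ, η τ = 1
  lower : ∀ τ, |τ| ≤ δ → 1 / (4 * δ) ≤ η τ

lemma exists_isMollifier {δ : ℝ} (hδ : 0 < δ) : ∃ η, IsMollifier δ η := by
  let φ : ContDiffBump (0 : ℝ) := ⟨δ, 2 * δ, hδ, by linarith⟩
  refine ⟨φ.normed volume, φ.contDiff_normed, fun τ => φ.nonneg_normed τ,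
    fun τ => φ.normed_neg τ, fun τ hτ => ?_, φ.integral_normed, fun τ hτ => ?_⟩
  · rw [φ.normed_def, φ.zero_of_le_dist (by simpa using hτ), zero_div]
  · rw [φ.normed_def, φ.one_of_mem_closedBall (by simpa using hτ)]
    have h1 := φ.integral_le_measure_closedBall (μ := volume)
    have h2 : volume.real (closedBall (0 : ℝ) φ.rOut) = 4 * δ := by
      rw [Measure.real, Real.volume_closedBall, ENNReal.toReal_ofReal (by
        have := φ.rOut_pos; linarith)]
      change 2 * (2 * δ) = 4 * δ
      ring
    rw [h2] at h1
    exact one_div_le_one_div_of_le φ.integral_pos h1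

lemma IsMollifier.exists_step {δ : ℝ} {η : ℝ → ℝ} (hη : IsMollifier δ η) (hδ : 0 < δ) (s : ℝ) :
    ∃ H : ℝ → ℝ, ContDiff ℝ (⊤ : ℕ∞) H ∧ (∀ t, deriv H t = η (t - s)) ∧ (∀ t, 0 ≤ H t) ∧
      (∀ t, H t ≤ 1) ∧ (∀ t, t ≤ s - 2 * δ → H t = 0) ∧ ∀ t, s + 2 * δ ≤ t → H t = 1 := by
  have hc : Continuous fun t => η (t - s) := hη.smooth.continuous.comp (by fun_prop)
  have hd : ∀ t, HasDerivAt (fun t => ∫ τ in (s - 3 * δ)..t, η (τ - s)) (η (t - s)) t := fun t =>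
    intervalIntegral.integral_hasDerivAt_right (hc.intervalIntegrable _ _)
      (hc.stronglyMeasurableAtFilter _ _) hc.continuousAt
  have hderiv : deriv (fun t => ∫ τ in (s - 3 * δ)..t, η (τ - s)) = fun t => η (t - s) :=
    funext fun t => (hd t).deriv
  have hmono : Monotone fun t => ∫ τ in (s - 3 * δ)..t, η (τ - s) :=
    monotone_of_deriv_nonneg (fun t => (hd t).differentiableAt) fun t => by
      rw [hderiv]; exact hη.nonneg _
  have hz : ∀ t, t ≤ s - 2 * δ → ∫ τ in (s - 3 * δ)..t, η (τ - s) = 0 := by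
    intro t ht
    refine intervalIntegral.integral_zero_ae (ae_of_all _ fun τ hτ => hη.zero _ ?_)
    have h1 : τ ≤ s - 2 * δ := hτ.2.trans (max_le (by linarith) ht)
    rw [le_abs]; right; linarith
  have ho : ∀ t, s + 2 * δ ≤ t → ∫ τ in (s - 3 * δ)..t, η (τ - s) = 1 := by
    intro t ht
    rw [intervalIntegral.integral_eq_integral_of_support_subset,
      integral_sub_right_eq_self (fun τ => η τ) s, hη.integral]
    intro τ hτ
    have h1 : |τ - s| < 2 * δ := by
      by_contra! h2
      exact hτ (hη.zero _ h2)
    rw [abs_lt] at h1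
    constructor <;> linarith
  refine ⟨fun t => ∫ τ in (s - 3 * δ)..t, η (τ - s), ?_, fun t => (hd t).deriv, fun t => ?_,
    fun t => ?_, hz, ho⟩
  · rw [contDiff_infty_iff_deriv]
    refine ⟨fun t => (hd t).differentiableAt, ?_⟩
    rw [hderiv]
    exact hη.smooth.comp (contDiff_id.sub contDiff_const)
  · calc (0 : ℝ) = _ := (hz _ (min_le_right t _)).symm
      _ ≤ _ := hmono (min_le_left _ _)
  · calc _ ≤ _ := hmono (le_max_left t (s + 2 * δ))
      _ = _ := ho _ (le_max_right _ _)

lemma lap_cutoff_kerN_le_everywhere {N : ℕ} (hN : 3 ≤ N) {r A : ℝ} {n : ℕ} {χ : Eu N → ℝ}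
    (hχ : IsCutoff r n A χ) (hn : 2 * N ≤ n) {σ : ℝ} (hσ : 0 < σ) (hσ' : σ ≤ 1 / 2) :
    ∃ C : ℝ, 0 ≤ C ∧ ∀ ε : ℝ, 0 < ε → ε ≤ 1 → ∀ x y : Eu N, ‖x‖ ≤ r →
      lap (fun y => χ y ^ (n + 2) * kerN σ ε x y) y ≤
        -(χ y ^ (n + 2) * (N * ε ^ 2 * qq ε x y ^ (-(N : ℝ) / 2 - 1))) + C := by
  obtain ⟨C, hC, h⟩ := lap_cutoff_kerN_le hN hχ hn hσ hσ' (4 * r ^ 2 + 1)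
  refine ⟨C, hC, fun ε hε hε1 x y hx => ?_⟩
  rcases le_or_gt ‖y‖ r with hy | hy
  · exact h ε hε x y (qq_le hε hε1 hx hy)
  · rw [lap_eq_zero (r := r) (fun z hz => by rw [hχ.pow_eq_zero hz, zero_mul]) hy,
      hχ.pow_eq_zero hy]
    simpa using hC

lemma FBound.integral_le {N n : ℕ} {f w : Eu N × ℝ → ℝ} {r α₀ β₀ γ Cu A : ℝ} {χ : Eu N → ℝ}
    (h : WeakData f w r α₀ β₀ γ Cu) (hχ : IsCutoff r n A χ) {b : ℝ} (hb : 0 < b)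
    (hF : FBound (fun y => χ y ^ (n + 2)) f α₀ β₀ r b) {α β : ℝ} (hα : α₀ < α) (hαβ : α ≤ β)
    (hβ : β < β₀) {k : ℝ → ℝ} (hk : Continuous k) (hk0 : ∀ t, 0 ≤ k t)
    (hkz : ∀ t, t ∉ Icc α β → k t = 0) :
    ∃ C : ℝ, ∀ (x : Eu N) (ε : ℝ), ‖x‖ ≤ r → 0 < ε → ε ≤ 1 →
      ∫ p, f p * (χ p.1 ^ (n + 2) * kern b ε x p.1 * k p.2) ≤ C := by
  obtain ⟨C, hC, hF⟩ := hF α β hα hαβ hβ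
  obtain ⟨M, hM⟩ := exists_bound_of_zero_outside_Icc hk hkz
  have hM0 : 0 ≤ M := (abs_nonneg _).trans (hM 0)
  refine ⟨(ENNReal.ofReal (M / b) * C).toReal, fun x ε hx hε hε1 => ?_⟩
  have hfin : ENNReal.ofReal (M / b) * C < ⊤ := ENNReal.mul_lt_top ENNReal.ofReal_lt_top hC
  have hq := fun y => Real.rpow_pos_of_pos (qq_pos hε x y) (-b / 2)
  have hmeas : Measurable fun p : Eu N × ℝ => f p * (χ p.1 ^ (n + 2) * kern b ε x p.1 * k p.2) := by
    have h1 := hχ.smooth.continuous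
    have h2 := (contDiff_kern hε b x).continuous
    have h3 := h.measf
    fun_prop
  rw [integral_eq_lintegral_of_nonneg_ae (ae_of_all _ fun p => ?_) hmeas.aestronglyMeasurable]
  · refine ENNReal.toReal_mono hfin.ne ?_
    refine le_trans ?_ (mul_le_mul_right (hF x ε hx hε hε1) _)
    rw [← lintegral_const_mul' _ _ ENNReal.ofReal_ne_top,
      ← lintegral_indicator (measurableSet_win _ _ _)]
    refine lintegral_mono fun p => ?_
    by_cases hp : p ∈ win N α β
    · rw [indicator_of_mem hp, ← ENNReal.ofReal_mul (by positivity)]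
      refine ENNReal.ofReal_le_ofReal ?_
      have e1 := h.f_nonneg p
      have e2 := hχ.pow_nonneg' (n := n) p.1
      have e3 := (hq p.1).le
      rw [kern]
      calc f p * (χ p.1 ^ (n + 2) * (qq ε x p.1 ^ (-b / 2) / b) * k p.2)
          ≤ f p * (χ p.1 ^ (n + 2) * (qq ε x p.1 ^ (-b / 2) / b) * M) := by
            gcongr
            exact (le_abs_self _).trans (hM _)
        _ = _ := by ring
    · rw [indicator_of_notMem hp, hkz _ (by rwa [mem_win] at hp)]
      simp
  · exact mul_nonneg (h.f_nonneg p) (mul_nonneg (mul_nonneg (hχ.pow_nonneg' _)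
      (div_nonneg (hq _).le hb.le)) (hk0 _))

lemma IsMollifier.bound {δ : ℝ} {η : ℝ → ℝ} (hη : IsMollifier δ η) : ∃ B, ∀ t, |η t| ≤ B :=
  exists_bound_of_zero_outside_Icc (α := -(2 * δ)) (β := 2 * δ) hη.smooth.continuous fun t ht =>
    hη.zero t (by
      by_contra! h
      rw [abs_lt] at h
      exact ht ⟨h.1.le, h.2.le⟩)

lemma integrable_tensor_mul {N : ℕ} {f : Eu N × ℝ → ℝ} (hf : Integrable f) {G : Eu N → ℝ}
    {a : ℝ → ℝ} (hG : Continuous G) (ha : Continuous a) {B B' : ℝ} (hB : ∀ y, |G y| ≤ B)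
    (hB' : ∀ t, |a t| ≤ B') : Integrable fun p => f p * (G p.1 * a p.2) := by
  refine integrable_mul_of_bound hf (C := B * B') (Continuous.measurable ?_) fun p => ?_
  · fun_prop
  · rw [abs_mul]
    exact mul_le_mul (hB _) (hB' _) (abs_nonneg _) ((abs_nonneg _).trans (hB p.1))

lemma contDiff_cutoff_kern {N n : ℕ} {r A : ℝ} {χ : Eu N → ℝ} (hχ : IsCutoff r n A χ) {ε : ℝ}
    (hε : 0 < ε) (b : ℝ) (x : Eu N) :
    ContDiff ℝ (⊤ : ℕ∞) (fun y => χ y ^ (n + 2) * kern b ε x y) :=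
  (hχ.smooth.pow _).mul (contDiff_kern hε _ x)

lemma contDiff_cutoff_kerN {N n : ℕ} {r A : ℝ} {χ : Eu N → ℝ} (hχ : IsCutoff r n A χ) {ε : ℝ}
    (hε : 0 < ε) (σ : ℝ) (x : Eu N) :
    ContDiff ℝ (⊤ : ℕ∞) (fun y => χ y ^ (n + 2) * kerN σ ε x y) :=
  (hχ.smooth.pow _).mul ((contDiff_kern hε _ x).add (contDiff_kern hε _ x))

/-- Newtonian potentials of time slices of `f` are bounded, uniformly in the slice. -/
lemma WeakData.potential_bound {N n : ℕ} (hN : 3 ≤ N) {f w : Eu N × ℝ → ℝ}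
    {r α₀ β₀ γ Cu A : ℝ} {χ : Eu N → ℝ} (h : WeakData f w r α₀ β₀ γ Cu) (hr : 0 ≤ r)
    (hγ : 0 ≤ γ) (hγ2 : γ < 2) (hχ : IsCutoff r n A χ) (hn : 2 * N ≤ n) {σ : ℝ} (hσ : 0 < σ)
    (hσ' : σ ≤ 1 / 2) {α₁ β₁ : ℝ} (hα : α₀ < α₁) (hαβ : α₁ ≤ β₁) (hβ : β₁ < β₀) :
    ∃ δ₀ C : ℝ, 0 < δ₀ ∧ 0 ≤ C ∧ ∀ (δ : ℝ) (η : ℝ → ℝ), 0 < δ → δ ≤ δ₀ → IsMollifier δ η →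
      ∀ (s : ℝ) (x : Eu N) (ε : ℝ), s ∈ Icc α₁ β₁ → ‖x‖ ≤ r → 0 < ε → ε ≤ 1 →
      ∫ p, f p * (χ p.1 ^ (n + 2) * kerN σ ε x p.1 * η (p.2 - s)) ≤ C := by
  have hN' : (3 : ℝ) ≤ N := by exact_mod_cast hN
  set d := α₁ - α₀ with hd
  have hd0 : 0 < d := sub_pos.2 hα
  set δb := d / 16 with hδb
  have hδb0 : 0 < δb := by positivity
  set sb := α₀ + d / 4 with hsb
  obtain ⟨ηb, hηb⟩ := exists_isMollifier hδb0
  obtain ⟨Hb, Hbs, Hbd, Hb0, Hb1, Hbz, Hbo⟩ := hηb.exists_step hδb0 sb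
  have hkz : ∀ t, t ∉ Icc (sb - 2 * δb) (sb + 2 * δb) → ηb (t - sb) = 0 := by
    intro t ht
    refine hηb.zero _ ?_
    by_contra! h'
    rw [abs_lt] at h'
    exact ht ⟨by linarith, by linarith⟩
  have hkc : Continuous fun t => ηb (t - sb) := hηb.smooth.continuous.comp (by fun_prop)
  obtain ⟨C₁, h₁⟩ := FBound.integral_le h hχ (b := N - 2) (by linarith)
    (FBound.all hN h hr hγ hγ2 hχ hn (by linarith) le_rfl) (α := sb - 2 * δb)
    (β := sb + 2 * δb) (by linarith) (by linarith) (by linarith) hkc (fun t => hηb.nonneg _) hkz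
  obtain ⟨C₂, h₂⟩ := FBound.integral_le h hχ (b := N - 2 - σ) (by linarith)
    (FBound.all hN h hr hγ hγ2 hχ hn (by linarith) (by linarith)) (α := sb - 2 * δb)
    (β := sb + 2 * δb) (by linarith) (by linarith) (by linarith) hkc (fun t => hηb.nonneg _) hkz
  obtain ⟨C₃, hC₃, h₃⟩ := lap_cutoff_kerN_le_everywhere hN hχ hn hσ hσ'
  refine ⟨min (d / 8) ((β₀ - β₁) / 2), |C₁ + C₂ + C₃ * ∫ p, w p|,
    lt_min (by positivity) (by linarith), abs_nonneg _, fun δ η hδ hδ₀ hη s x ε hs hx hε hε1 => ?_⟩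
  refine le_trans ?_ (le_abs_self _)
  have hδ1 : δ ≤ d / 8 := hδ₀.trans (min_le_left _ _)
  have hδ2 : δ ≤ (β₀ - β₁) / 2 := hδ₀.trans (min_le_right _ _)
  have hs1 := hs.1
  have hs2 := hs.2
  obtain ⟨H, Hs, Hd, H0, H1, Hz, Ho⟩ := hη.exists_step hδ s
  have hle : ∀ t, H t ≤ Hb t := by
    intro t
    rcases le_total t (s - 2 * δ) with ht | ht
    · rw [Hz t ht]; exact Hb0 t
    · rw [Hbo t (by linarith)]; exact H1 t
  have haz : ∀ t, t ∉ Icc α₀ β₀ → H t - Hb t = 0 := by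
    intro t ht
    rw [mem_Icc, not_and_or, not_le, not_le] at ht
    rcases ht with ht | ht
    · rw [Hz t (by linarith), Hbz t (by linarith), sub_zero]
    · rw [Ho t (by linarith), Hbo t (by linarith), sub_self]
  have hda : ∀ t, deriv (fun t => H t - Hb t) t = η (t - s) - ηb (t - sb) := by
    intro t
    rw [deriv_fun_sub (Hs.differentiable (by simp) t) (Hbs.differentiable (by simp) t), Hd, Hbd]
  have hG0 : ∀ (k : Eu N → ℝ) (y : Eu N), r < ‖y‖ → χ y ^ (n + 2) * k y = 0 := fun k y hy => by
    rw [hχ.pow_eq_zero hy, zero_mul]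
  obtain ⟨-, i2, he⟩ := h.tensor (contDiff_cutoff_kerN hχ hε σ x) (Hs.sub Hbs) (hG0 _) haz
  simp only [hda] at he
  obtain ⟨B, hB⟩ := hη.bound
  obtain ⟨Bb, hBb⟩ := hηb.bound
  obtain ⟨BG, hBG⟩ := exists_bound_of_zero_outside_ball
    (contDiff_cutoff_kerN hχ hε σ x).continuous (hG0 _)
  obtain ⟨B1, hB1⟩ := exists_bound_of_zero_outside_ball
    (contDiff_cutoff_kern hχ hε (N - 2) x).continuous (hG0 _)
  obtain ⟨B2, hB2⟩ := exists_bound_of_zero_outside_ball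
    (contDiff_cutoff_kern hχ hε (N - 2 - σ) x).continuous (hG0 _)
  have hηc : Continuous fun t => η (t - s) := hη.smooth.continuous.comp (by fun_prop)
  have j1 := integrable_tensor_mul h.intf (contDiff_cutoff_kerN hχ hε σ x).continuous hηc hBG
    fun t => hB _
  have j3 := integrable_tensor_mul h.intf (contDiff_cutoff_kern hχ hε (N - 2) x).continuous hkc hB1
    fun t => hBb _
  have j4 := integrable_tensor_mul h.intf (contDiff_cutoff_kern hχ hε (N - 2 - σ) x).continuous hkc
    hB2 fun t => hBb _
  have hsplit : ∫ p, f p * (χ p.1 ^ (n + 2) * kerN σ ε x p.1 * (η (p.2 - s) - ηb (p.2 - sb))) =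
      (∫ p, f p * (χ p.1 ^ (n + 2) * kerN σ ε x p.1 * η (p.2 - s))) -
      ((∫ p, f p * (χ p.1 ^ (n + 2) * kern (N - 2) ε x p.1 * ηb (p.2 - sb))) +
      ∫ p, f p * (χ p.1 ^ (n + 2) * kern (N - 2 - σ) ε x p.1 * ηb (p.2 - sb))) := by
    rw [← integral_add j3 j4]
    refine Eq.trans ?_ (integral_sub j1 (j3.add j4))
    refine integral_congr_ae (ae_of_all _ fun p => ?_)
    simp only [kerN]
    ring
  rw [hsplit] at he
  have hlast : ∫ p, w p * ((H p.2 - Hb p.2) * -lap (fun y => χ y ^ (n + 2) * kerN σ ε x y) p.1) ≤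
      C₃ * ∫ p, w p := by
    rw [← integral_const_mul]
    refine integral_mono i2 (h.intw.const_mul _) fun p => ?_
    have e1 := h₃ ε hε hε1 x p.1 hx
    have e2 : 0 ≤ χ p.1 ^ (n + 2) * (N * ε ^ 2 * qq ε x p.1 ^ (-(N : ℝ) / 2 - 1)) :=
      mul_nonneg (hχ.pow_nonneg' _) (mul_nonneg (by positivity)
        (Real.rpow_pos_of_pos (qq_pos hε x p.1) _).le)
    have e3 := hle p.2
    have e4 : Hb p.2 - H p.2 ≤ 1 := by linarith [Hb1 p.2, H0 p.2]
    have e5 := h.w_nonneg p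
    have e6 : (Hb p.2 - H p.2) * lap (fun y => χ y ^ (n + 2) * kerN σ ε x y) p.1 ≤ C₃ := by
      calc _ ≤ (Hb p.2 - H p.2) * C₃ := by
            have : 0 ≤ Hb p.2 - H p.2 := by linarith
            gcongr
            linarith
        _ ≤ 1 * C₃ := by gcongr
        _ = C₃ := one_mul _
    have e7 := mul_le_mul_of_nonneg_left e6 e5
    simp only
    linarith
  have k1 := h₁ x ε hx hε hε1
  have k2 := h₂ x ε hx hε hε1
  linarith

lemma le_kerN {N : ℕ} (hN : 3 ≤ N) {σ : ℝ} (hσ' : σ ≤ 1 / 2) {r ε : ℝ} (hε : 0 < ε) (hε1 : ε ≤ 1)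
    {x y : Eu N} (hx : ‖x‖ ≤ r) (hy : ‖y‖ ≤ r) :
    (4 * r ^ 2 + 1) ^ (-((N : ℝ) - 2) / 2) / (N - 2) ≤ kerN σ ε x y := by
  have hN' : (3 : ℝ) ≤ N := by exact_mod_cast hN
  have hq := qq_pos hε x y
  have h1 : (4 * r ^ 2 + 1) ^ (-((N : ℝ) - 2) / 2) ≤ qq ε x y ^ (-((N : ℝ) - 2) / 2) :=
    Real.rpow_le_rpow_of_nonpos hq (qq_le hε hε1 hx hy) (by linarith)
  have h2 : 0 ≤ kern (N - 2 - σ) ε x y := div_nonneg (Real.rpow_pos_of_pos hq _).le (by linarith)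
  have h3 : (4 * r ^ 2 + 1) ^ (-((N : ℝ) - 2) / 2) / (N - 2) ≤ kern (N - 2) ε x y :=
    div_le_div_of_nonneg_right h1 (by linarith)
  unfold kerN
  linarith

lemma WeakData.slice_bound {N n : ℕ} (hN : 3 ≤ N) {f w : Eu N × ℝ → ℝ}
    {r α₀ β₀ γ Cu A : ℝ} {χ : Eu N → ℝ} (h : WeakData f w r α₀ β₀ γ Cu) (hr : 0 ≤ r)
    (hγ : 0 ≤ γ) (hγ2 : γ < 2) (hχ : IsCutoff r n A χ) (hn : 2 * N ≤ n)
    {α₁ β₁ : ℝ} (hα : α₀ < α₁) (hαβ : α₁ ≤ β₁) (hβ : β₁ < β₀) :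
    ∃ δ₀ C : ℝ, 0 < δ₀ ∧ 0 ≤ C ∧ ∀ (δ : ℝ) (η : ℝ → ℝ), 0 < δ → δ ≤ δ₀ → IsMollifier δ η →
      ∀ s ∈ Icc α₁ β₁, ∫ p, f p * (χ p.1 ^ (n + 2) * η (p.2 - s)) ≤ C := by
  have hN' : (3 : ℝ) ≤ N := by exact_mod_cast hN
  obtain ⟨δ₀, C, hδ₀, hC, hP⟩ := h.potential_bound hN hr hγ hγ2 hχ hn (σ := 1 / 2) (by norm_num)
    le_rfl hα hαβ hβ
  set c : ℝ := (4 * r ^ 2 + 1) ^ (-((N : ℝ) - 2) / 2) / (N - 2) with hc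
  have hc0 : 0 < c := div_pos (by positivity) (by linarith)
  refine ⟨δ₀, C / c, hδ₀, by positivity, fun δ η hδ hδ' hη s hs => ?_⟩
  rw [le_div_iff₀ hc0, ← integral_mul_const]
  obtain ⟨B, hB⟩ := hη.bound
  have hηc : Continuous fun t => η (t - s) := hη.smooth.continuous.comp (by fun_prop)
  obtain ⟨B', hB'⟩ := exists_bound_of_zero_outside_ball (r := r)
    (contDiff_cutoff_kerN hχ one_pos (1 / 2) (0 : Eu N)).continuous
    fun y hy => by rw [hχ.pow_eq_zero hy, zero_mul]
  refine le_trans (integral_mono (Integrable.mul_const ?_ _) ?_ fun p => ?_)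
    (hP δ η hδ hδ' hη s 0 1 hs (by simpa using hr) one_pos le_rfl)
  · exact integrable_tensor_mul h.intf (G := fun y => χ y ^ (n + 2))
      (hχ.smooth.continuous.pow (n + 2)) hηc (B := 1)
      (fun y => by rw [abs_of_nonneg (hχ.pow_nonneg' y)]; exact hχ.pow_le_one' y) fun t => hB _
  · exact integrable_tensor_mul h.intf
      (contDiff_cutoff_kerN hχ one_pos (1 / 2) (0 : Eu N)).continuous hηc hB' fun t => hB _
  · have e1 := h.f_nonneg p
    have e2 := hχ.pow_nonneg' (n := n) p.1
    have e3 := hη.nonneg (p.2 - s)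
    simp only
    rcases le_or_gt ‖p.1‖ r with hp | hp
    · have := le_kerN hN (σ := 1 / 2) le_rfl one_pos le_rfl (x := 0) (r := r) (by simpa using hr) hp
      calc f p * (χ p.1 ^ (n + 2) * η (p.2 - s)) * c
          = f p * (χ p.1 ^ (n + 2) * c * η (p.2 - s)) := by ring
        _ ≤ _ := by gcongr
    · rw [hχ.pow_eq_zero hp]; simp

/-- Bounded measurable real functions. -/
def BddMeas {α : Type*} [MeasurableSpace α] (k : α → ℝ) : Prop :=
  Measurable k ∧ ∃ C, ∀ q, |k q| ≤ C

namespace BddMeas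

variable {α β : Type*} [MeasurableSpace α] [MeasurableSpace β]

lemma mul {k l : α → ℝ} (hk : BddMeas k) (hl : BddMeas l) : BddMeas fun q => k q * l q := by
  obtain ⟨hk, C, hC⟩ := hk
  obtain ⟨hl, C', hC'⟩ := hl
  refine ⟨hk.mul hl, C * C', fun q => ?_⟩
  rw [abs_mul]
  exact mul_le_mul (hC _) (hC' _) (abs_nonneg _) ((abs_nonneg _).trans (hC q))

lemma add {k l : α → ℝ} (hk : BddMeas k) (hl : BddMeas l) : BddMeas fun q => k q + l q := by
  obtain ⟨hk, C, hC⟩ := hk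
  obtain ⟨hl, C', hC'⟩ := hl
  exact ⟨hk.add hl, C + C', fun q => (abs_add_le _ _).trans (add_le_add (hC q) (hC' q))⟩

lemma const (c : ℝ) : BddMeas fun _ : α => c := ⟨measurable_const, |c|, fun _ => le_rfl⟩

lemma comp {k : β → ℝ} (hk : BddMeas k) {g : α → β} (hg : Measurable g) :
    BddMeas fun q => k (g q) :=
  ⟨hk.1.comp hg, hk.2.imp fun _ h _ => h _⟩

lemma integrable {μ : Measure α} {k F : α → ℝ} (hk : BddMeas k) (hF : Integrable F μ) :
    Integrable (fun q => F q * k q) μ :=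
  let ⟨_, hC⟩ := hk.2
  integrable_mul_of_bound hF hk.1 hC

variable {μ : Measure α} {ν : Measure β} {k : α × β → ℝ} {F : α → ℝ} {W : β → ℝ}

lemma section_left (hk : BddMeas k) (z : α) : BddMeas fun p => k (z, p) :=
  hk.comp (g := fun p => (z, p)) (by fun_prop)

lemma section_right (hk : BddMeas k) (p : β) : BddMeas fun z => k (z, p) :=
  hk.comp (g := fun z => (z, p)) (by fun_prop)

lemma integrable_pair (hk : BddMeas k) (hF : Integrable F μ) (hW : Integrable W ν) :
    Integrable (fun q => F q.1 * (W q.2 * k q)) (μ.prod ν) :=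
  (hk.integrable (hF.mul_prod hW)).congr (ae_of_all _ fun _ => mul_assoc _ _ _)

lemma integral_pair [SFinite μ] [SFinite ν] (hk : BddMeas k) (hF : Integrable F μ)
    (hW : Integrable W ν) :
    Integrable (fun z => F z * ∫ p, W p * k (z, p) ∂ν) μ ∧
    ∫ q, F q.1 * (W q.2 * k q) ∂(μ.prod ν) = ∫ z, F z * ∫ p, W p * k (z, p) ∂ν ∂μ := by
  have h := hk.integrable_pair hF hW
  constructor
  · simpa only [integral_const_mul] using h.integral_prod_left
  · simpa only [integral_const_mul] using integral_prod _ h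

lemma integral_pair_symm [SFinite μ] [SFinite ν] (hk : BddMeas k) (hF : Integrable F μ)
    (hW : Integrable W ν) :
    Integrable (fun p => W p * ∫ z, F z * k (z, p) ∂μ) ν ∧
    ∫ q, F q.1 * (W q.2 * k q) ∂(μ.prod ν) = ∫ p, W p * ∫ z, F z * k (z, p) ∂μ ∂ν := by
  have h := hk.integrable_pair hF hW
  constructor
  · simpa only [mul_left_comm (F _) (W _), integral_const_mul] using h.integral_prod_right
  · simpa only [mul_left_comm (F _) (W _), integral_const_mul] using integral_prod_symm _ h

end BddMeas

lemma bddMeas_qq_rpow {N : ℕ} {ε : ℝ} (hε : 0 < ε) {a : ℝ} (ha : a ≤ 0) :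
    BddMeas fun q : Eu N × Eu N => qq ε q.1 q.2 ^ a := by
  refine ⟨Continuous.measurable ?_, (ε ^ 2) ^ a, fun q => ?_⟩
  · exact Continuous.rpow_const (by unfold qq; fun_prop) fun _ => Or.inl (qq_pos hε _ _).ne'
  · rw [abs_of_pos (Real.rpow_pos_of_pos (qq_pos hε _ _) _)]
    exact Real.rpow_le_rpow_of_nonpos (by positivity)
      (by unfold qq; nlinarith [sq_nonneg ‖q.2 - q.1‖]) ha

lemma bddMeas_kern {N : ℕ} {ε b : ℝ} (hε : 0 < ε) (hb : 0 ≤ b) :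
    BddMeas fun q : Eu N × Eu N => kern b ε q.1 q.2 := by
  simp only [kern, div_eq_mul_inv]
  exact (bddMeas_qq_rpow hε (by linarith)).mul (.const _)

lemma bddMeas_kerN {N : ℕ} (hN : 3 ≤ N) {σ : ℝ} (hσ' : σ ≤ 1 / 2) {ε : ℝ} (hε : 0 < ε) :
    BddMeas fun q : Eu N × Eu N => kerN σ ε q.1 q.2 := by
  have hN' : (3 : ℝ) ≤ N := by exact_mod_cast hN
  exact (bddMeas_kern hε (by linarith)).add (bddMeas_kern hε (by linarith))

lemma kerN_comm {N : ℕ} (σ ε : ℝ) (x y : Eu N) : kerN σ ε x y = kerN σ ε y x := by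
  unfold kerN
  rw [kern_comm, kern_comm (_ - _) ε x y]

lemma kerN_nonneg {N : ℕ} (hN : 3 ≤ N) {σ : ℝ} (hσ' : σ ≤ 1 / 2) {ε : ℝ} (hε : 0 < ε)
    (x y : Eu N) : 0 ≤ kerN σ ε x y := by
  have hN' : (3 : ℝ) ≤ N := by exact_mod_cast hN
  exact add_nonneg (div_nonneg (Real.rpow_pos_of_pos (qq_pos hε _ _) _).le (by linarith))
    (div_nonneg (Real.rpow_pos_of_pos (qq_pos hε _ _) _).le (by linarith))

lemma IsCutoff.bddMeas {N n : ℕ} {r A : ℝ} {χ : Eu N → ℝ} (hχ : IsCutoff r n A χ) :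
    BddMeas fun y => χ y ^ (n + 2) :=
  ⟨(hχ.smooth.continuous.pow (n + 2)).measurable, 1, fun y => by
    rw [abs_of_nonneg (hχ.pow_nonneg' y)]; exact hχ.pow_le_one' y⟩

lemma IsMollifier.deriv_neg {δ : ℝ} {η : ℝ → ℝ} (hη : IsMollifier δ η) (τ : ℝ) :
    deriv η (-τ) = -deriv η τ := by
  have h : (fun τ => η (-τ)) = η := funext hη.even
  have := deriv_comp_neg η τ
  rw [h] at this
  rw [this, neg_neg]

lemma IsMollifier.bddMeas_deriv {δ : ℝ} {η : ℝ → ℝ} (hη : IsMollifier δ η) :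
    BddMeas (deriv η) := by
  have hc : Continuous (deriv η) := hη.smooth.continuous_deriv (by simp)
  refine ⟨hc.measurable, exists_bound_of_zero_outside_Icc (α := -(2 * δ)) (β := 2 * δ) hc
    fun t => deriv_eq_zero_outside_Icc fun t ht => hη.zero t (by
      by_contra! h
      rw [abs_lt] at h
      exact ht ⟨h.1.le, h.2.le⟩)⟩

lemma IsMollifier.bddMeas {δ : ℝ} {η : ℝ → ℝ} (hη : IsMollifier δ η) : BddMeas η :=
  ⟨hη.smooth.continuous.measurable, hη.bound⟩

/-- A smooth time cutoff supported in `[α, β]`. -/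
structure IsTimeCutoff (α β M : ℝ) (φ : ℝ → ℝ) : Prop where
  smooth : ContDiff ℝ (⊤ : ℕ∞) φ
  nonneg : ∀ t, 0 ≤ φ t
  le_one : ∀ t, φ t ≤ 1
  zero : ∀ t, t ∉ Icc α β → φ t = 0
  bound_nonneg : 0 ≤ M
  deriv_bound : ∀ t, |deriv φ t| ≤ M

lemma IsTimeCutoff.bddMeas {α β M : ℝ} {φ : ℝ → ℝ} (h : IsTimeCutoff α β M φ) : BddMeas φ :=
  ⟨h.smooth.continuous.measurable, 1, fun t => by
    rw [abs_of_nonneg (h.nonneg t)]; exact h.le_one t⟩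

lemma IsTimeCutoff.bddMeas_deriv {α β M : ℝ} {φ : ℝ → ℝ} (h : IsTimeCutoff α β M φ) :
    BddMeas (deriv φ) :=
  ⟨(h.smooth.continuous_deriv (by simp)).measurable, M, h.deriv_bound⟩

lemma integral_antisymm_eq_zero {α : Type*} [MeasurableSpace α] {μ : Measure α} [SFinite μ]
    {F : α × α → ℝ} (h : ∀ q, F q.swap = -F q) : ∫ q, F q ∂(μ.prod μ) = 0 := by
  have h1 := integral_prod_swap (μ := μ) (ν := μ) F
  simp only [h, integral_neg] at h1
  linarith

/-- The double integral of `f` against `w`, localised by the approximate identity given by the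
Laplacian of the regularised Newtonian kernel, is bounded. -/
lemma WeakData.energy_bound {N n : ℕ} (hN : 3 ≤ N) {f w : Eu N × ℝ → ℝ}
    {r α₀ β₀ γ Cu A : ℝ} {χ : Eu N → ℝ} (h : WeakData f w r α₀ β₀ γ Cu) (hr : 0 ≤ r)
    (hγ : 0 ≤ γ) (hγ2 : γ < 2) (hχ : IsCutoff r n A χ) (hn : 2 * N ≤ n)
    {α₁ β₁ M : ℝ} (hα : α₀ < α₁) (hαβ : α₁ ≤ β₁) (hβ : β₁ < β₀) {φ : ℝ → ℝ}
    (hφ : IsTimeCutoff α₁ β₁ M φ) :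
    ∃ δ₀ C : ℝ, 0 < δ₀ ∧ 0 ≤ C ∧ ∀ (δ ε : ℝ) (η : ℝ → ℝ), 0 < δ → δ ≤ δ₀ → IsMollifier δ η →
      0 < ε → ε ≤ 1 →
      ∫ q : (Eu N × ℝ) × (Eu N × ℝ), f q.1 * (χ q.1.1 ^ (n + 2) * φ q.1.2) *
        (w q.2 * (φ q.2.2 * η (q.2.2 - q.1.2) *
          (χ q.2.1 ^ (n + 2) * (N * ε ^ 2 * qq ε q.1.1 q.2.1 ^ (-(N : ℝ) / 2 - 1))))) ≤ C := by
  have hN' : (3 : ℝ) ≤ N := by exact_mod_cast hN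
  obtain ⟨δ₁, P, hδ₁, hP0, hP⟩ := h.potential_bound hN hr hγ hγ2 hχ hn (σ := 1 / 2) (by norm_num)
    le_rfl hα hαβ hβ
  obtain ⟨δ₂, C₂, hδ₂, hC₂, h₂⟩ := h.slice_bound hN hr hγ hγ2 hχ hn hα hαβ hβ
  obtain ⟨C₃, hC₃, h₃⟩ := lap_cutoff_kerN_le_everywhere hN hχ hn (σ := 1 / 2) (by norm_num) le_rfl
  set H : Eu N × ℝ → ℝ := fun z => f z * (χ z.1 ^ (n + 2) * φ z.2) with hH
  have hHb : BddMeas fun z : Eu N × ℝ => χ z.1 ^ (n + 2) * φ z.2 :=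
    (hχ.bddMeas.comp measurable_fst).mul (hφ.bddMeas.comp measurable_snd)
  have hHi : Integrable H := hHb.integrable h.intf
  have hH0 : ∀ z, 0 ≤ H z := fun z =>
    mul_nonneg (h.f_nonneg z) (mul_nonneg (hχ.pow_nonneg' _) (hφ.nonneg _))
  have hHz : ∀ z, H z ≠ 0 → ‖z.1‖ ≤ r ∧ z.2 ∈ Icc α₁ β₁ := by
    intro z hz
    constructor
    · by_contra! h'
      exact hz (by simp [hH, hχ.pow_eq_zero h'])
    · by_contra h'
      exact hz (by simp [hH, hφ.zero _ h'])
  have hHle : ∀ z, H z ≤ f z * χ z.1 ^ (n + 2) := fun z =>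
    mul_le_mul_of_nonneg_left
      (mul_le_of_le_one_right (hχ.pow_nonneg' _) (hφ.le_one _)) (h.f_nonneg z)
  refine ⟨min δ₁ δ₂, M * P * (∫ z, H z) + C₃ * (C₂ * ∫ p, w p), lt_min hδ₁ hδ₂,
    add_nonneg (mul_nonneg (mul_nonneg hφ.bound_nonneg hP0) (integral_nonneg hH0))
      (mul_nonneg hC₃ (mul_nonneg hC₂ (integral_nonneg h.w_nonneg))),
    fun δ ε η hδ hδ' hη hε hε1 => ?_⟩
  have hδ1 := hδ'.trans (min_le_left _ _)
  have hδ2 := hδ'.trans (min_le_right _ _)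
  have bη : BddMeas fun q : (Eu N × ℝ) × (Eu N × ℝ) => η (q.2.2 - q.1.2) :=
    hη.bddMeas.comp (by fun_prop)
  have bη' : BddMeas fun q : (Eu N × ℝ) × (Eu N × ℝ) => deriv η (q.2.2 - q.1.2) :=
    hη.bddMeas_deriv.comp (by fun_prop)
  have bφ : BddMeas fun q : (Eu N × ℝ) × (Eu N × ℝ) => φ q.2.2 := hφ.bddMeas.comp (by fun_prop)
  have bφ' : BddMeas fun q : (Eu N × ℝ) × (Eu N × ℝ) => deriv φ q.2.2 :=
    hφ.bddMeas_deriv.comp (by fun_prop)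
  have bχ : BddMeas fun q : (Eu N × ℝ) × (Eu N × ℝ) => χ q.2.1 ^ (n + 2) :=
    hχ.bddMeas.comp (by fun_prop)
  have bK : BddMeas fun q : (Eu N × ℝ) × (Eu N × ℝ) => kerN (1 / 2) ε q.1.1 q.2.1 :=
    (bddMeas_kerN hN (σ := 1 / 2) le_rfl hε).comp
      (g := fun q : (Eu N × ℝ) × (Eu N × ℝ) => (q.1.1, q.2.1)) (by fun_prop)
  have bκ : BddMeas fun q : (Eu N × ℝ) × (Eu N × ℝ) =>
      N * ε ^ 2 * qq ε q.1.1 q.2.1 ^ (-(N : ℝ) / 2 - 1) :=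
    (BddMeas.const _).mul ((bddMeas_qq_rpow hε (by linarith)).comp
      (g := fun q : (Eu N × ℝ) × (Eu N × ℝ) => (q.1.1, q.2.1)) (by fun_prop))
  have b1 := (bφ.mul bη).mul (bχ.mul bκ)
  have b2 := (bχ.mul bK).mul (bφ'.mul bη)
  have b3 := (bχ.mul bK).mul (bφ.mul bη')
  have b4 := bφ.mul bη
  obtain ⟨i1, e1⟩ := b1.integral_pair hHi h.intw
  obtain ⟨i2, e2⟩ := b2.integral_pair hHi h.intf
  obtain ⟨i3, e3⟩ := b3.integral_pair hHi h.intf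
  obtain ⟨i4, e4⟩ := b4.integral_pair hHi h.intw
  obtain ⟨i5, e5⟩ := b4.integral_pair_symm hHi h.intw
  have key : ∀ z, H z * (∫ p, w p * (φ p.2 * η (p.2 - z.2) *
      (χ p.1 ^ (n + 2) * (N * ε ^ 2 * qq ε z.1 p.1 ^ (-(N : ℝ) / 2 - 1))))) ≤
      H z * (∫ p, f p * (χ p.1 ^ (n + 2) * kerN (1 / 2) ε z.1 p.1 *
        (deriv φ p.2 * η (p.2 - z.2)))) +
      H z * (∫ p, f p * (χ p.1 ^ (n + 2) * kerN (1 / 2) ε z.1 p.1 *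
        (φ p.2 * deriv η (p.2 - z.2)))) +
      C₃ * (H z * ∫ p, w p * (φ p.2 * η (p.2 - z.2))) := by
    intro z
    by_cases hz : H z = 0
    · simp [hz]
    obtain ⟨hz1, -⟩ := hHz z hz
    have ha : ContDiff ℝ (⊤ : ℕ∞) fun s => φ s * η (s - z.2) :=
      hφ.smooth.mul (hη.smooth.comp (contDiff_id.sub contDiff_const))
    have hda : ∀ s, deriv (fun s => φ s * η (s - z.2)) s =
        deriv φ s * η (s - z.2) + φ s * deriv η (s - z.2) := by
      intro s
      have h1 : HasDerivAt φ (deriv φ s) s := (hφ.smooth.differentiable (by simp) s).hasDerivAt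
      have h2 : HasDerivAt (fun s => η (s - z.2)) (deriv η (s - z.2)) s :=
        ((hη.smooth.differentiable (by simp) _).hasDerivAt).comp_sub_const s z.2
      exact (h1.mul h2).deriv
    obtain ⟨-, t2, te⟩ := h.tensor (contDiff_cutoff_kerN hχ hε (1 / 2) z.1) ha
      (fun y hy => by rw [hχ.pow_eq_zero hy, zero_mul]) (fun s hs => by
        rw [hφ.zero s fun hs' => hs ⟨hα.le.trans hs'.1, hs'.2.trans hβ.le⟩, zero_mul])
    have s1 := (b1.section_left z).integrable h.intw
    have s2 := (b2.section_left z).integrable h.intf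
    have s3 := (b3.section_left z).integrable h.intf
    have s4 := (b4.section_left z).integrable h.intw
    have te' : ∫ p, f p * (χ p.1 ^ (n + 2) * kerN (1 / 2) ε z.1 p.1 *
          deriv (fun s => φ s * η (s - z.2)) p.2) =
        (∫ p, f p * (χ p.1 ^ (n + 2) * kerN (1 / 2) ε z.1 p.1 *
          (deriv φ p.2 * η (p.2 - z.2)))) +
        ∫ p, f p * (χ p.1 ^ (n + 2) * kerN (1 / 2) ε z.1 p.1 *
          (φ p.2 * deriv η (p.2 - z.2))) := by
      refine Eq.trans ?_ (integral_add s2 s3)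
      refine integral_congr_ae (ae_of_all _ fun p => ?_)
      simp only [hda]
      ring
    have le1 : ∫ p, w p * (φ p.2 * η (p.2 - z.2) *
        (χ p.1 ^ (n + 2) * (N * ε ^ 2 * qq ε z.1 p.1 ^ (-(N : ℝ) / 2 - 1)))) ≤
        (∫ p, w p * (φ p.2 * η (p.2 - z.2) *
          -lap (fun y => χ y ^ (n + 2) * kerN (1 / 2) ε z.1 y) p.1)) +
        C₃ * ∫ p, w p * (φ p.2 * η (p.2 - z.2)) := by
      rw [← integral_const_mul]
      refine le_trans (integral_mono s1 (t2.add (s4.const_mul C₃)) fun p => ?_)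
        (integral_add t2 (s4.const_mul C₃)).le
      have l1 := h₃ ε hε hε1 z.1 p.1 hz1
      have l2 : 0 ≤ w p * (φ p.2 * η (p.2 - z.2)) :=
        mul_nonneg (h.w_nonneg p) (mul_nonneg (hφ.nonneg _) (hη.nonneg _))
      have l3 := mul_le_mul_of_nonneg_left l1 l2
      simp only [Pi.add_apply]
      linarith
    rw [te, te'] at le1
    have := mul_le_mul_of_nonneg_left le1 (hH0 z)
    linarith
  have tot := integral_mono i1 ((i2.add i3).add (i4.const_mul C₃)) key
  have tot2 := integral_add (i2.add i3) (i4.const_mul C₃)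
  have tot3 := integral_add i2 i3
  have tot4 := integral_const_mul (μ := (volume : Measure (Eu N × ℝ))) C₃
    fun z => H z * ∫ p, w p * (φ p.2 * η (p.2 - z.2))
  have f2 : ∫ z, H z * (∫ p, f p * (χ p.1 ^ (n + 2) * kerN (1 / 2) ε z.1 p.1 *
      (deriv φ p.2 * η (p.2 - z.2)))) ≤ M * P * ∫ z, H z := by
    rw [← integral_const_mul]
    refine integral_mono i2 (hHi.const_mul _) fun z => ?_
    simp only
    by_cases hz : H z = 0
    · simp [hz]
    obtain ⟨hz1, hz2⟩ := hHz z hz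
    rw [mul_comm]
    refine mul_le_mul_of_nonneg_right ?_ (hH0 z)
    refine le_trans ?_ (mul_le_mul_of_nonneg_left
      (hP δ η hδ hδ1 hη z.2 z.1 ε hz2 hz1 hε hε1) hφ.bound_nonneg)
    rw [← integral_const_mul]
    refine integral_mono ((b2.section_left z).integrable h.intf)
      ((((bχ.mul bK).mul bη).section_left z |>.integrable h.intf).const_mul M) fun p => ?_
    have l1 : 0 ≤ f p * (χ p.1 ^ (n + 2) * kerN (1 / 2) ε z.1 p.1 * η (p.2 - z.2)) :=
      mul_nonneg (h.f_nonneg p) (mul_nonneg (mul_nonneg (hχ.pow_nonneg' _)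
        (kerN_nonneg hN le_rfl hε _ _)) (hη.nonneg _))
    have := mul_le_mul_of_nonneg_left ((le_abs_self _).trans (hφ.deriv_bound p.2)) l1
    simp only
    linarith
  have f3 : ∫ q : (Eu N × ℝ) × (Eu N × ℝ), H q.1 * (f q.2 * (χ q.2.1 ^ (n + 2) *
      kerN (1 / 2) ε q.1.1 q.2.1 * (φ q.2.2 * deriv η (q.2.2 - q.1.2))))
      ∂((volume : Measure (Eu N × ℝ)).prod volume) = 0 := by
    refine integral_antisymm_eq_zero fun q => ?_
    simp only [Prod.fst_swap, Prod.snd_swap, hH]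
    rw [kerN_comm _ _ q.2.1 q.1.1, ← neg_sub q.2.2 q.1.2, hη.deriv_neg]
    ring
  have f4 : ∫ p, w p * (∫ z, H z * (φ p.2 * η (p.2 - z.2))) ≤ C₂ * ∫ p, w p := by
    rw [← integral_const_mul]
    refine integral_mono i5 (h.intw.const_mul _) fun p => ?_
    simp only
    rw [mul_comm]
    refine mul_le_mul_of_nonneg_right ?_ (h.w_nonneg p)
    by_cases hp : p.2 ∈ Icc α₁ β₁
    · refine le_trans ?_ (h₂ δ η hδ hδ2 hη p.2 hp)
      refine integral_mono ((b4.section_right p).integrable hHi)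
        ((((hχ.bddMeas.comp measurable_fst).mul (hη.bddMeas.comp (g := fun z : Eu N × ℝ =>
          z.2 - p.2) (by fun_prop))).integrable h.intf)) fun z => ?_
      have l1 : η (p.2 - z.2) = η (z.2 - p.2) := by rw [← neg_sub, hη.even]
      have l2 := hη.nonneg (z.2 - p.2)
      simp only [l1]
      calc H z * (φ p.2 * η (z.2 - p.2)) ≤ f z * χ z.1 ^ (n + 2) * (1 * η (z.2 - p.2)) :=
            mul_le_mul (hHle z) (mul_le_mul_of_nonneg_right (hφ.le_one _) l2)
              (mul_nonneg (hφ.nonneg _) l2) ((hH0 z).trans (hHle z))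
        _ = _ := by ring
    · simpa [hφ.zero _ hp] using hC₂
  have f4' := mul_le_mul_of_nonneg_left f4 hC₃
  rw [Measure.volume_eq_prod, e1]
  rw [e3] at f3
  rw [e4] at e5
  simp only [Pi.add_apply] at tot tot2 tot3 f3 e5
  rw [tot2, tot3, f3, tot4, e5] at tot
  linarith

instance isAddHaarMeasure_spacetime {N : ℕ} :
    Measure.IsAddHaarMeasure (volume : Measure (Eu N × ℝ)) :=
  inferInstanceAs (Measure.IsAddHaarMeasure ((volume : Measure (Eu N)).prod volume))

/-- If the double integral of `H ⊗ g` over `ε`-neighbourhoods of the diagonal is controlled by the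
volume of an `ε`-ball, then `H * g` is integrable. -/
lemma lintegral_mul_le_of_near_diagonal {E : Type*} [NormedAddCommGroup E] [NormedSpace ℝ E]
    [FiniteDimensional ℝ E] [MeasurableSpace E] [BorelSpace E] (μ : Measure E)
    [μ.IsAddHaarMeasure] {H g : E → ℝ} (hH : Integrable H μ) (hg : Integrable g μ)
    (hH0 : ∀ z, 0 ≤ H z) (hg0 : ∀ z, 0 ≤ g z) {ε₀ C : ℝ} (hε₀ : 0 < ε₀)
    (h : ∀ ε, 0 < ε → ε ≤ ε₀ →
      ∫ q, H q.1 * (g q.2 * {q : E × E | dist q.2 q.1 ≤ ε}.indicator 1 q) ∂(μ.prod μ) ≤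
        C * ε ^ Module.finrank ℝ E) :
    ∫⁻ z, ENNReal.ofReal (H z * g z) ∂μ < ⊤ := by
  set d := Module.finrank ℝ E with hd
  set v : ℝ := μ.real (ball 0 1) with hv
  have hv0 : 0 < v := ENNReal.toReal_pos (measure_ball_pos μ 0 one_pos).ne' measure_ball_lt_top.ne
  set e : ℕ → ℝ := fun n => ε₀ / (n + 1) with he
  have he0 : ∀ n, 0 < e n := fun n => by positivity
  have he1 : ∀ n, e n ≤ ε₀ := fun n => div_le_self hε₀.le (by linarith [n.cast_nonneg (α := ℝ)])
  have het : Tendsto e atTop (𝓝[>] 0) := by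
    rw [tendsto_nhdsWithin_iff]
    refine ⟨?_, Eventually.of_forall he0⟩
    have := (tendsto_one_div_add_atTop_nhds_zero_nat (𝕜 := ℝ)).const_mul ε₀
    simpa [he, div_eq_mul_inv] using this
  have hind : ∀ ε : ℝ, BddMeas ({q : E × E | dist q.2 q.1 ≤ ε}.indicator (1 : E × E → ℝ)) := by
    intro ε
    refine ⟨measurable_one.indicator (measurableSet_le (by fun_prop) (by fun_prop)), 1, fun q => ?_⟩
    by_cases hq : q ∈ {q : E × E | dist q.2 q.1 ≤ ε} <;> simp [indicator, hq]
  set F : ℕ → E → ℝ := fun n z => H z * ⨍ p in closedBall z (e n), g p ∂μ with hF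
  have hvol : ∀ n z, μ.real (closedBall z (e n)) = e n ^ d * v := by
    intro n z
    rw [Measure.real, Measure.addHaar_closedBall μ z (he0 n).le, ENNReal.toReal_mul,
      ENNReal.toReal_ofReal (pow_nonneg (he0 n).le _)]
    rfl
  have hFeq : ∀ n z, F n z = (e n ^ d * v)⁻¹ * (H z * ∫ p, g p *
      {q : E × E | dist q.2 q.1 ≤ e n}.indicator 1 (z, p) ∂μ) := by
    intro n z
    simp only [hF]
    rw [setAverage_eq, hvol, ← integral_indicator measurableSet_closedBall, smul_eq_mul]
    have : ∀ p, (closedBall z (e n)).indicator g p =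
        g p * {q : E × E | dist q.2 q.1 ≤ e n}.indicator 1 (z, p) := by
      intro p
      by_cases hp : dist p z ≤ e n <;> simp [indicator, hp]
    simp only [this]
    ring
  have hF0 : ∀ n z, 0 ≤ F n z := by
    intro n z
    rw [hFeq]
    refine mul_nonneg (inv_nonneg.2 (mul_nonneg (pow_nonneg (he0 n).le _) hv0.le))
      (mul_nonneg (hH0 z) (integral_nonneg fun p => mul_nonneg (hg0 p) ?_))
    exact indicator_nonneg (fun _ _ => zero_le_one) _
  have hFi : ∀ n, Integrable (F n) μ ∧ ∫ z, F n z ∂μ ≤ C / v := by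
    intro n
    obtain ⟨i1, e1⟩ := (hind (e n)).integral_pair hH hg
    have hfun : F n = fun z => (e n ^ d * v)⁻¹ * (H z * ∫ p, g p *
      {q : E × E | dist q.2 q.1 ≤ e n}.indicator 1 (z, p) ∂μ) := funext (hFeq n)
    rw [hfun]
    refine ⟨i1.const_mul _, ?_⟩
    rw [integral_const_mul, ← e1]
    have hp := pow_pos (he0 n) d
    calc _ ≤ (e n ^ d * v)⁻¹ * (C * e n ^ d) :=
          mul_le_mul_of_nonneg_left (h _ (he0 n) (he1 n)) (inv_nonneg.2 (mul_pos hp hv0).le)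
      _ = C / v := by field_simp
  refine lt_of_le_of_lt (lintegral_ofReal_le_of_liminf (F := F) (C := ENNReal.ofReal (C / v))
    (fun n => (hFi n).1.aemeasurable) ?_ fun n => ?_) ENNReal.ofReal_lt_top
  · filter_upwards [IsUnifLocDoublingMeasure.ae_tendsto_average μ hg.locallyIntegrable 1] with z hz
    refine ⟨_, le_rfl, Or.inl ?_⟩
    refine Tendsto.const_mul _ (hz (fun _ => z) e het (Eventually.of_forall fun n => ?_))
    exact mem_closedBall_self (by rw [one_mul]; exact (he0 n).le)
  · rw [← ofReal_integral_eq_lintegral_ofReal (hFi n).1 (ae_of_all _ (hF0 n))]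
    exact ENNReal.ofReal_le_ofReal (hFi n).2

lemma WeakData.lintegral_mul_cutoff_lt_top {N n : ℕ} (hN : 3 ≤ N) {f w : Eu N × ℝ → ℝ}
    {r α₀ β₀ γ Cu A : ℝ} {χ : Eu N → ℝ} (h : WeakData f w r α₀ β₀ γ Cu) (hr : 0 ≤ r)
    (hγ : 0 ≤ γ) (hγ2 : γ < 2) (hχ : IsCutoff r n A χ) (hn : 2 * N ≤ n)
    {α₁ β₁ M : ℝ} (hα : α₀ < α₁) (hαβ : α₁ ≤ β₁) (hβ : β₁ < β₀) {φ : ℝ → ℝ}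
    (hφ : IsTimeCutoff α₁ β₁ M φ) :
    ∫⁻ z : Eu N × ℝ, ENNReal.ofReal (f z * (χ z.1 ^ (n + 2) * φ z.2) *
      (w z * (χ z.1 ^ (n + 2) * φ z.2))) < ⊤ := by
  have hN' : (3 : ℝ) ≤ N := by exact_mod_cast hN
  obtain ⟨δ₀, C, hδ₀, hC, hE⟩ := h.energy_bound hN hr hγ hγ2 hχ hn hα hαβ hβ hφ
  have hb : BddMeas fun z : Eu N × ℝ => χ z.1 ^ (n + 2) * φ z.2 :=
    (hχ.bddMeas.comp measurable_fst).mul (hφ.bddMeas.comp measurable_snd)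
  have hb0 : ∀ z : Eu N × ℝ, 0 ≤ χ z.1 ^ (n + 2) * φ z.2 := fun z =>
    mul_nonneg (hχ.pow_nonneg' _) (hφ.nonneg _)
  set c : ℝ := 4 * 2 ^ ((N : ℝ) / 2 + 1) / N with hc
  have hc0 : 0 < c := by positivity
  refine lintegral_mul_le_of_near_diagonal (ε₀ := min δ₀ 1) (C := c * C) volume
    (hb.integrable h.intf) (hb.integrable h.intw) (fun z => mul_nonneg (h.f_nonneg z) (hb0 z))
    (fun z => mul_nonneg (h.w_nonneg z) (hb0 z)) (lt_min hδ₀ one_pos) fun ε hε hε' => ?_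
  have hε1 := hε'.trans (min_le_right _ _)
  obtain ⟨η, hη⟩ := exists_isMollifier hε
  have hE1 := hE ε ε η hε (hε'.trans (min_le_left _ _)) hη hε hε1
  have hdim : Module.finrank ℝ (Eu N × ℝ) = N + 1 := by simp
  rw [hdim]
  have hind : BddMeas ({q : (Eu N × ℝ) × (Eu N × ℝ) | dist q.2 q.1 ≤ ε}.indicator
      (1 : (Eu N × ℝ) × (Eu N × ℝ) → ℝ)) := by
    refine ⟨measurable_one.indicator (measurableSet_le (by fun_prop) (by fun_prop)), 1, fun q => ?_⟩
    by_cases hq : q ∈ {q : (Eu N × ℝ) × (Eu N × ℝ) | dist q.2 q.1 ≤ ε} <;> simp [indicator, hq]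
  have bκ : BddMeas fun q : (Eu N × ℝ) × (Eu N × ℝ) => φ q.2.2 * η (q.2.2 - q.1.2) *
      (χ q.2.1 ^ (n + 2) * (N * ε ^ 2 * qq ε q.1.1 q.2.1 ^ (-(N : ℝ) / 2 - 1))) :=
    ((hφ.bddMeas.comp (by fun_prop)).mul (hη.bddMeas.comp (by fun_prop))).mul
      ((hχ.bddMeas.comp (g := fun q : (Eu N × ℝ) × (Eu N × ℝ) => q.2.1) (by fun_prop)).mul
        ((BddMeas.const _).mul ((bddMeas_qq_rpow hε (by linarith)).comp
          (g := fun q : (Eu N × ℝ) × (Eu N × ℝ) => (q.1.1, q.2.1)) (by fun_prop))))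
  have I1 := bκ.integrable_pair (μ := (volume : Measure (Eu N × ℝ))) (hb.integrable h.intf) h.intw
  have I2 := hind.integrable_pair (μ := (volume : Measure (Eu N × ℝ))) (hb.integrable h.intf)
    (hb.integrable h.intw)
  refine le_trans (integral_mono I2 (I1.const_mul (c * ε ^ (N + 1))) fun q => ?_) ?_
  · have a1 : 0 ≤ f q.1 * (χ q.1.1 ^ (n + 2) * φ q.1.2) := mul_nonneg (h.f_nonneg _) (hb0 _)
    have a2 := h.w_nonneg q.2
    have a3 := hb0 q.2
    have hqp := qq_pos hε q.1.1 q.2.1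
    have a4 : 0 ≤ N * ε ^ 2 * qq ε q.1.1 q.2.1 ^ (-(N : ℝ) / 2 - 1) :=
      mul_nonneg (by positivity) (Real.rpow_pos_of_pos hqp _).le
    have a5 := hη.nonneg (q.2.2 - q.1.2)
    by_cases hq : dist q.2 q.1 ≤ ε
    · have hq1 : ‖q.2.1 - q.1.1‖ ≤ ε := by
        rw [← dist_eq_norm]; exact (le_max_left _ _).trans hq
      have hq2 : |q.2.2 - q.1.2| ≤ ε := by
        rw [← Real.dist_eq]; exact (le_max_right _ _).trans hq
      have m1 := hη.lower _ hq2
      have m2 : (2 * ε ^ 2) ^ (-(N : ℝ) / 2 - 1) ≤ qq ε q.1.1 q.2.1 ^ (-(N : ℝ) / 2 - 1) := by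
        refine Real.rpow_le_rpow_of_nonpos hqp ?_ (by linarith)
        unfold qq
        have := pow_le_pow_left₀ (norm_nonneg _) hq1 2
        linarith
      have m3 : (2 * ε ^ 2) ^ (-(N : ℝ) / 2 - 1) = (2 ^ ((N : ℝ) / 2 + 1) * ε ^ (N + 2))⁻¹ := by
        rw [show -(N : ℝ) / 2 - 1 = -((N : ℝ) / 2 + 1) by ring, Real.rpow_neg (by positivity),
          Real.mul_rpow (by norm_num) (by positivity), ← Real.rpow_natCast ε 2,
          ← Real.rpow_mul hε.le, ← Real.rpow_natCast ε (N + 2)]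
        congr 3
        push_cast
        ring
      rw [m3] at m2
      have m4 : 1 ≤ c * ε ^ (N + 1) * (η (q.2.2 - q.1.2) *
          (N * ε ^ 2 * qq ε q.1.1 q.2.1 ^ (-(N : ℝ) / 2 - 1))) := by
        calc (1 : ℝ) = c * ε ^ (N + 1) * (1 / (4 * ε) *
              (N * ε ^ 2 * (2 ^ ((N : ℝ) / 2 + 1) * ε ^ (N + 2))⁻¹)) := by
              rw [hc]
              have : (2 : ℝ) ^ ((N : ℝ) / 2 + 1) ≠ 0 := by positivity
              field_simp
              ring
          _ ≤ _ := by gcongr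
      have m5 : 0 ≤ f q.1 * (χ q.1.1 ^ (n + 2) * φ q.1.2) *
          (w q.2 * (χ q.2.1 ^ (n + 2) * φ q.2.2)) := mul_nonneg a1 (mul_nonneg a2 a3)
      have m6 := mul_le_mul_of_nonneg_left m4 m5
      simp only [indicator, mem_ofPred_eq, hq, if_true, Pi.one_apply]
      linarith
    · simp only [indicator, mem_ofPred_eq, hq, if_false, mul_zero]
      refine mul_nonneg (by positivity) (mul_nonneg a1 (mul_nonneg a2 ?_))
      exact mul_nonneg (mul_nonneg (hφ.nonneg _) a5) (mul_nonneg (hχ.pow_nonneg' _) a4)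
  · rw [integral_const_mul]
    calc _ ≤ c * ε ^ (N + 1) * C := by
          refine mul_le_mul_of_nonneg_left ?_ (by positivity)
          exact hE1
      _ = _ := by ring

/-- Local integrability of `f * w`. -/
lemma WeakData.setLIntegral_mul_lt_top {N : ℕ} (hN : 3 ≤ N) {f w : Eu N × ℝ → ℝ}
    {r α₀ β₀ γ Cu : ℝ} (h : WeakData f w r α₀ β₀ γ Cu) (hγ : 0 ≤ γ) (hγ2 : γ < 2)
    {r₁ α₁ β₁ : ℝ} (hr₁ : 0 < r₁) (hr : r₁ < r) (hα : α₀ < α₁) (hαβ : α₁ ≤ β₁) (hβ : β₁ < β₀) :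
    ∫⁻ z in closedBall (0 : Eu N) r₁ ×ˢ Icc α₁ β₁, ENNReal.ofReal (f z * w z) < ⊤ := by
  obtain ⟨A, χ, hχ, hχ1⟩ := exists_isCutoff N hr₁ hr (2 * N)
  set δ := min ((α₁ - α₀) / 2) ((β₀ - β₁) / 2) with hδ
  have hδ0 : 0 < δ := lt_min (by linarith) (by linarith)
  have hδ1 : δ ≤ (α₁ - α₀) / 2 := min_le_left _ _
  have hδ2 : δ ≤ (β₀ - β₁) / 2 := min_le_right _ _
  obtain ⟨φ, M, s1, s2, s3, s4, s5, s6, s7⟩ := exists_time_cutoff hαβ hδ0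
  have hφ : IsTimeCutoff (α₁ - δ) (β₁ + δ) M φ := ⟨s1, s2, s3, s5, s6, s7⟩
  refine lt_of_le_of_lt ?_ (h.lintegral_mul_cutoff_lt_top hN (hr₁.le.trans hr.le) hγ hγ2 hχ le_rfl
    (by linarith) (by linarith) (by linarith) hφ)
  have hm : MeasurableSet (closedBall (0 : Eu N) r₁ ×ˢ Icc α₁ β₁) :=
    measurableSet_closedBall.prod measurableSet_Icc
  rw [← lintegral_indicator hm]
  refine lintegral_mono fun z => ?_
  by_cases hz : z ∈ closedBall (0 : Eu N) r₁ ×ˢ Icc α₁ β₁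
  · rw [indicator_of_mem hz, hχ1 _ (by simpa using hz.1), s4 _ hz.2]
    simp
  · rw [indicator_of_notMem hz]
    exact zero_le

lemma exists_window_of_isCompact {N : ℕ} {R T : ℝ} (hR : 0 < R) {K : Set (Eu N × ℝ)}
    (hK : IsCompact K) (hne : K.Nonempty) (hsub : K ⊆ ball (0 : Eu N) R ×ˢ Ioo 0 T) :
    ∃ r₁ α₁ β₁ : ℝ, 0 < r₁ ∧ r₁ < R ∧ 0 < α₁ ∧ α₁ ≤ β₁ ∧ β₁ < T ∧
      K ⊆ closedBall (0 : Eu N) r₁ ×ˢ Icc α₁ β₁ := by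
  obtain ⟨p, hp, hp'⟩ := hK.exists_isMaxOn hne (f := fun p => ‖p.1‖) (by fun_prop)
  obtain ⟨a, ha, ha'⟩ := hK.exists_isMinOn hne (f := fun p => p.2) (by fun_prop)
  obtain ⟨b, hb, hb'⟩ := hK.exists_isMaxOn hne (f := fun p => p.2) (by fun_prop)
  refine ⟨max ‖p.1‖ (R / 2), a.2, b.2, lt_max_of_lt_right (by linarith),
    max_lt (by simpa using (hsub hp).1) (by linarith), (hsub ha).2.1, ha' hb, (hsub hb).2.2,
    fun q hq => ⟨?_, ha' hq, hb' hq⟩⟩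
  rw [mem_closedBall_zero_iff]
  exact le_max_of_le_left (hp' hq)

/-- A very weak solution with boundary data on a cylinder yields, after truncation, the abstract
data for the local estimate. -/
lemma exists_weakData {N : ℕ} {m γ Cl Cu : ℝ} (hm : 1 < m) {T R : ℝ}
    {ρ : Eu N → ℝ} (hρ : WeightCond N γ Cl Cu ρ) {u : Eu N → ℝ → ℝ}
    (humeas : AEMeasurable (fun p : Eu N × ℝ => u p.1 p.2)
      (volume.restrict (ball (0 : Eu N) R ×ˢ Ioo 0 T)))
    (hpos : ∀ᵐ p ∂(volume.restrict (ball (0 : Eu N) R ×ˢ Ioo 0 T) : Measure (Eu N × ℝ)),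
      0 ≤ u p.1 p.2)
    {S : ℝ} (hST : S < T)
    (hint₁ : IntegrableOn (fun p : Eu N × ℝ => u p.1 p.2 * ρ p.1) (ball (0 : Eu N) R ×ˢ Ioo 0 S))
    (hintm : IntegrableOn (fun p : Eu N × ℝ => |u p.1 p.2| ^ m) (ball (0 : Eu N) R ×ˢ Ioo 0 S))
    {r α₀ β₀ : ℝ} (hβ₀ : β₀ < S)
    (hweak : ∀ (G : Eu N → ℝ) (a : ℝ → ℝ), ContDiff ℝ (⊤ : ℕ∞) G → ContDiff ℝ (⊤ : ℕ∞) a →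
      (∀ y, r < ‖y‖ → G y = 0) → (∀ t, t ∉ Icc α₀ β₀ → a t = 0) →
      ∫ p in ball (0 : Eu N) R ×ˢ Ioo 0 T,
        (u p.1 p.2 * (G p.1 * deriv a p.2) * ρ p.1 +
          spow (u p.1 p.2) m * (a p.2 * lap G p.1)) = 0) :
    ∃ f w : Eu N × ℝ → ℝ, WeakData f w r α₀ β₀ γ Cu ∧
      ∀ᵐ p : Eu N × ℝ, p ∈ ball (0 : Eu N) R ×ˢ Ioo 0 S →
        |u p.1 p.2| ^ (m + 1) * ρ p.1 = f p * w p := by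
  obtain ⟨hρm, hγ, hγ2, hCl, hClu, hρb⟩ := hρ
  set Q : Set (Eu N × ℝ) := ball (0 : Eu N) R ×ˢ Ioo 0 S with hQ
  have hQm : MeasurableSet Q := measurableSet_ball.prod measurableSet_Ioo
  have hQm' : MeasurableSet (ball (0 : Eu N) R ×ˢ Ioo 0 T) :=
    measurableSet_ball.prod measurableSet_Ioo
  have hQQ : Q ⊆ ball (0 : Eu N) R ×ˢ Ioo 0 T :=
    prod_mono_right (Ioo_subset_Ioo_right hST.le)
  set u₀ : Eu N × ℝ → ℝ := Q.indicator fun p => |humeas.mk _ p| with hu₀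
  have hu₀m : Measurable u₀ := (humeas.measurable_mk.abs).indicator hQm
  have hu₀0 : ∀ p, 0 ≤ u₀ p := fun p => indicator_nonneg (fun _ _ => abs_nonneg _) p
  have hu₀z : ∀ p, p ∉ Q → u₀ p = 0 := fun p hp => indicator_of_notMem hp _
  have hm0 : m ≠ 0 := by linarith
  have hρ' : ∀ᵐ p : Eu N × ℝ, 0 < ρ p.1 ∧ ρ p.1 ≤ Cu * ‖p.1‖ ^ (-γ) := by
    have := Measure.quasiMeasurePreserving_fst (μ := (volume : Measure (Eu N)))
      (ν := (volume : Measure ℝ)) |>.ae hρb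
    rw [← Measure.volume_eq_prod] at this
    filter_upwards [this] with p hp
    exact ⟨lt_of_lt_of_le (by positivity) hp.1, hp.2⟩
  have huu : ∀ᵐ p : Eu N × ℝ, p ∈ Q → u p.1 p.2 = u₀ p ∧ 0 ≤ u p.1 p.2 := by
    filter_upwards [(ae_restrict_iff' hQm').1 humeas.ae_eq_mk, (ae_restrict_iff' hQm').1 hpos]
      with p h1 h2 hp
    refine ⟨?_, h2 (hQQ hp)⟩
    rw [hu₀, indicator_of_mem hp, ← h1 (hQQ hp), abs_of_nonneg (h2 (hQQ hp))]
  refine ⟨fun p => |ρ p.1| * u₀ p, fun p => u₀ p ^ m, ?_, ?_⟩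
  · refine ⟨?_, ?_, fun p => mul_nonneg (abs_nonneg _) (hu₀0 p),
      fun p => Real.rpow_nonneg (hu₀0 p) _, ?_, ?_, fun G a hG ha hG0 ha0 => ?_,
      (hCl.trans hClu).le, ?_⟩
    · exact (hρm.comp measurable_fst).abs.mul hu₀m
    · exact hu₀m.pow_const m
    · rw [← integrableOn_iff_integrable_of_support_subset (s := Q)]
      · refine hint₁.congr ((ae_restrict_iff' hQm).2 ?_)
        filter_upwards [huu, hρ'] with p h1 h2 hp
        rw [(h1 hp).1, abs_of_pos h2.1, mul_comm]
      · intro p hp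
        by_contra h'
        exact hp (by simp [hu₀z p h'])
    · rw [← integrableOn_iff_integrable_of_support_subset (s := Q)]
      · refine hintm.congr ((ae_restrict_iff' hQm).2 ?_)
        filter_upwards [huu] with p h1 hp
        rw [(h1 hp).1, abs_of_nonneg (hu₀0 p)]
      · intro p hp
        by_contra h'
        exact hp (by simp [hu₀z p h', Real.zero_rpow hm0])
    · rw [← hweak G a hG ha hG0 ha0, ← setIntegral_eq_integral_of_forall_compl_eq_zero
        (s := ball (0 : Eu N) R ×ˢ Ioo 0 T)]
      · refine setIntegral_congr_ae hQm' ?_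
        filter_upwards [huu, hρ'] with p h1 h2 hp
        by_cases hpQ : p ∈ Q
        · rw [spow, (h1 hpQ).1, abs_of_pos h2.1, abs_of_nonneg (hu₀0 p)]
          have : u₀ p ^ (m - 1) * u₀ p = u₀ p ^ m := by
            rw [← Real.rpow_add_one' (hu₀0 p) (by linarith), sub_add_cancel]
          rw [this]
          ring
        · have hp2 : p.2 ∉ Icc α₀ β₀ := fun h' =>
            hpQ ⟨hp.1, hp.2.1, h'.2.trans_lt hβ₀⟩
          rw [hu₀z p hpQ, ha0 _ hp2, deriv_eq_zero_outside_Icc ha0 hp2]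
          simp
      · intro p hp
        rw [hu₀z p fun h' => hp (hQQ h'), Real.zero_rpow hm0]
        simp
    · filter_upwards [hρ'] with p hp
      rw [abs_of_pos hp.1]
      refine mul_le_mul hp.2 ?_ (hu₀0 p) (hp.1.le.trans hp.2)
      have h0 := Real.rpow_nonneg (hu₀0 p) m
      rcases le_total (u₀ p) 1 with h1 | h1
      · linarith
      · have := Real.rpow_le_rpow_of_exponent_le h1 hm.le
        rw [Real.rpow_one] at this
        linarith
  · filter_upwards [huu, hρ'] with p h1 h2 hp
    rw [(h1 hp).1, abs_of_nonneg (hu₀0 p), abs_of_pos h2.1,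
      Real.rpow_add_one' (hu₀0 p) (by linarith)]
    ring

/-- The very weak formulation with boundary term, tested against products. -/
lemma weak_tensor_of_boundary {N : ℕ} {m : ℝ} {T R : ℝ} {ρ : Eu N → ℝ} {u g : Eu N → ℝ → ℝ}
    (hweak : ∀ ψ : Eu N × ℝ → ℝ, ContDiff ℝ (⊤ : ℕ∞) ψ →
      (∃ a b : ℝ, 0 < a ∧ b < T ∧ ∀ x : Eu N, ∀ t : ℝ, t ∉ Icc a b → ψ (x, t) = 0) →
      (∀ y ∈ sphere (0 : Eu N) R, ∀ t : ℝ, ψ (y, t) = 0) →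
      ∫ p in ball (0 : Eu N) R ×ˢ Ioo 0 T,
          (u p.1 p.2 * ptder ψ p * ρ p.1 + spow (u p.1 p.2) m * lapX ψ p) =
        ∫ t in Ioo (0:ℝ) T, ∫ y in sphere (0 : Eu N) R,
          g y t * fderiv ℝ (fun x => ψ (x, t)) y (R⁻¹ • y) ∂(μH[(N:ℝ) - 1]))
    {r α₀ β₀ : ℝ} (hr : r < R) (hα₀ : 0 < α₀) (hβ₀ : β₀ < T) {G : Eu N → ℝ} {a : ℝ → ℝ}
    (hG : ContDiff ℝ (⊤ : ℕ∞) G) (ha : ContDiff ℝ (⊤ : ℕ∞) a)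
    (hG0 : ∀ y, r < ‖y‖ → G y = 0) (ha0 : ∀ t, t ∉ Icc α₀ β₀ → a t = 0) :
    ∫ p in ball (0 : Eu N) R ×ˢ Ioo 0 T,
      (u p.1 p.2 * (G p.1 * deriv a p.2) * ρ p.1 +
        spow (u p.1 p.2) m * (a p.2 * lap G p.1)) = 0 := by
  have h := hweak (fun p => G p.1 * a p.2) ((hG.comp contDiff_fst).mul (ha.comp contDiff_snd))
    ⟨α₀, β₀, hα₀, hβ₀, fun x t ht => by simp [ha0 t ht]⟩ (fun y hy t => by
      rw [mem_sphere_zero_iff_norm] at hy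
      simp [hG0 y (by linarith)])
  simp only [ptder_tensor hG ha, lapX_tensor hG ha] at h
  rw [h]
  refine setIntegral_eq_zero_of_forall_eq_zero fun t _ =>
    setIntegral_eq_zero_of_forall_eq_zero fun y hy => ?_
  rw [mem_sphere_zero_iff_norm] at hy
  have : (fun x => G x * a t) =ᶠ[𝓝 y] fun _ => 0 := by
    filter_upwards [(isOpen_lt continuous_const continuous_norm).mem_nhds
      (show r < ‖y‖ by linarith)] with z hz
    simp [hG0 z hz]
  rw [this.fderiv_eq]
  simp

/-- **Lemma 7.5**: a non-negative function satisfying the localized very weak formulation of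
`ρ u_t = Δ(u^m)` on `B_R × (0,T)` with integrable boundary data `g` (the trace of `u^m` on
`∂B_R × (0,T)`) belongs to `L^{m+1}_{ρ,loc}(B_R × (0,T))`. -/
theorem stmt_19 {N : ℕ} (hN : 3 ≤ N) (m γ Cl Cu : ℝ) (hm : 1 < m)
    (T R : ℝ) (hT : 0 < T) (hR : 0 < R)
    (ρ : Eu N → ℝ) (hρ : WeightCond N γ Cl Cu ρ)
    (u : Eu N → ℝ → ℝ)
    (humeas : AEMeasurable (fun p : Eu N × ℝ => u p.1 p.2)
      (volume.restrict (ball (0 : Eu N) R ×ˢ Ioo 0 T)))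
    (hpos : ∀ᵐ p ∂(volume.restrict (ball (0 : Eu N) R ×ˢ Ioo 0 T) : Measure (Eu N × ℝ)),
      0 ≤ u p.1 p.2)
    (hint₁ : ∀ S : ℝ, 0 < S → S < T →
      IntegrableOn (fun p : Eu N × ℝ => u p.1 p.2 * ρ p.1) (ball (0 : Eu N) R ×ˢ Ioo 0 S))
    (hintm : ∀ S : ℝ, 0 < S → S < T →
      IntegrableOn (fun p : Eu N × ℝ => |u p.1 p.2| ^ m) (ball (0 : Eu N) R ×ˢ Ioo 0 S))
    (g : Eu N → ℝ → ℝ)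
    (hg : Integrable (fun q : Eu N × ℝ => g q.1 q.2)
      (((μH[(N:ℝ) - 1] : Measure (Eu N)).restrict (sphere (0 : Eu N) R)).prod
        (volume.restrict (Ioo 0 T))))
    (hweak : ∀ ψ : Eu N × ℝ → ℝ, ContDiff ℝ (⊤ : ℕ∞) ψ →
      (∃ a b : ℝ, 0 < a ∧ b < T ∧ ∀ x : Eu N, ∀ t : ℝ, t ∉ Icc a b → ψ (x, t) = 0) →
      (∀ y ∈ sphere (0 : Eu N) R, ∀ t : ℝ, ψ (y, t) = 0) →
      ∫ p in ball (0 : Eu N) R ×ˢ Ioo 0 T,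
          (u p.1 p.2 * ptder ψ p * ρ p.1 + spow (u p.1 p.2) m * lapX ψ p) =
        ∫ t in Ioo (0:ℝ) T, ∫ y in sphere (0 : Eu N) R,
          g y t * fderiv ℝ (fun x => ψ (x, t)) y (R⁻¹ • y) ∂(μH[(N:ℝ) - 1])) :
    ∀ K : Set (Eu N × ℝ), IsCompact K → K ⊆ ball (0 : Eu N) R ×ˢ Ioo 0 T →
      ∫⁻ p in K, ENNReal.ofReal (|u p.1 p.2| ^ (m + 1) * ρ p.1) < ⊤ := by
  intro K hK hsub
  rcases K.eq_empty_or_nonempty with rfl | hne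
  · simp
  obtain ⟨r₁, α₁, β₁, hr₁, hr₁R, hα₁, hαβ, hβ₁, hKs⟩ := exists_window_of_isCompact hR hK hne hsub
  have hS0 : 0 < (β₁ + T) / 2 := by linarith
  have hST : (β₁ + T) / 2 < T := by linarith
  obtain ⟨f, w, hfw, heq⟩ := exists_weakData hm hρ humeas hpos hST (hint₁ _ hS0 hST)
    (hintm _ hS0 hST) (r := (r₁ + R) / 2) (α₀ := α₁ / 2) (β₀ := (β₁ + (β₁ + T) / 2) / 2)
    (by linarith) fun G a hG ha hG0 ha0 =>
      weak_tensor_of_boundary hweak (r := (r₁ + R) / 2) (α₀ := α₁ / 2)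
        (β₀ := (β₁ + (β₁ + T) / 2) / 2) (by linarith) (by linarith) (by linarith) hG ha hG0 ha0
  refine lt_of_le_of_lt ?_ (hfw.setLIntegral_mul_lt_top hN hρ.2.1 hρ.2.2.1 hr₁ (by linarith)
    (α₁ := α₁) (β₁ := β₁) (by linarith) hαβ (by linarith))
  calc ∫⁻ p in K, ENNReal.ofReal (|u p.1 p.2| ^ (m + 1) * ρ p.1)
      = ∫⁻ p in K, ENNReal.ofReal (f p * w p) := by
        refine setLIntegral_congr_fun_ae hK.measurableSet ?_
        filter_upwards [heq] with p hp hpK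
        have h1 := hKs hpK
        rw [hp ⟨(hsub hpK).1, (hsub hpK).2.1, by linarith [h1.2.2]⟩]
    _ ≤ _ := lintegral_mono_set hKs
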